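/- arXiv:0907.0737 — 3 statements merged into one kernel-verified Lean document; each statement's English description precedes it below -/
import Mathlib

section
/- Let (F, φ) be a TC flow on D² and let h ∈ E⁺(F). Then there exists a C^∞ function α : D² ∖ {O} → ℝ such that h(z) = φ(z, α(z)) for all z ∈ D² ∖ {O}. Moreover, if β : D² ∖ {O} → ℝ is any other C^∞ function with h(z) = φ(z, β(z)) for all z ∈ D² ∖ {O}, then there exists n ∈ ℤ such that β(z) = α(z) + n·θ(z) for all z ∈ D² ∖ {O}, where θ is the minimal period function of φ. -/
open Set

noncomputable section

/-- Points of the plane. -/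
abbrev Pt : Type := ℝ × ℝ

/-- The closed unit disk `D² = {x² + y² ≤ 1}`. -/
def diskD : Set Pt := {p | p.1 ^ 2 + p.2 ^ 2 ≤ 1}

/-- The origin `O = (0,0)`. -/
def ptO : Pt := (0, 0)

/-- The boundary circle `∂D² = {x² + y² = 1}`. -/
def bdD : Set Pt := {p | p.1 ^ 2 + p.2 ^ 2 = 1}

/-- A TC ("topological center") flow on the disk `D²`: a `C^∞` vector field `F` on `D²`
together with its flow `φ`, such that `O` is the unique singular point of `F` in `D²`,
the boundary circle is an orbit, and every nonsingular point is periodic. -/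
structure TCFlow where
  /-- the vector field -/
  F : Pt → Pt
  /-- the flow of `F` -/
  φ : Pt → ℝ → Pt
  F_smooth : ContDiffOn ℝ (⊤ : ℕ∞) F diskD
  φ_smooth : ContDiffOn ℝ (⊤ : ℕ∞) (fun p : Pt × ℝ => φ p.1 p.2) (diskD ×ˢ (univ : Set ℝ))
  φ_mapsTo : ∀ z ∈ diskD, ∀ t : ℝ, φ z t ∈ diskD
  φ_zero : ∀ z ∈ diskD, φ z 0 = z
  φ_add : ∀ z ∈ diskD, ∀ s t : ℝ, φ (φ z s) t = φ z (s + t)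
  φ_deriv : ∀ z ∈ diskD, ∀ t : ℝ, HasDerivAt (φ z) (F (φ z t)) t
  F_zero_iff : ∀ z ∈ diskD, (F z = 0 ↔ z = ptO)
  bd_orbit : ∀ z ∈ bdD, {p : Pt | ∃ t : ℝ, φ z t = p} = bdD
  periodic : ∀ z ∈ diskD, z ≠ ptO → ∃ t : ℝ, 0 < t ∧ φ z t = z

/-- The orbit of a point under the flow. -/
def orb (Φ : TCFlow) (z : Pt) : Set Pt := Set.range (Φ.φ z)

/-- `h ∈ E(F)`: a `C^∞` self-map of `D²` preserving each orbit of `F` and restricting to a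
`C^∞` diffeomorphism between some open neighbourhoods of `O` in `D²`. -/
def Emem (Φ : TCFlow) (h : Pt → Pt) : Prop :=
  Set.MapsTo h diskD diskD ∧
  ContDiffOn ℝ (⊤ : ℕ∞) h diskD ∧
  (∀ z ∈ diskD, h '' orb Φ z = orb Φ z) ∧
  (∃ U V : Set Pt, IsOpen U ∧ IsOpen V ∧ ptO ∈ U ∧ ptO ∈ V ∧ U ⊆ diskD ∧ V ⊆ diskD ∧
    Set.BijOn h U V ∧
    ∃ g : Pt → Pt, ContDiffOn ℝ (⊤ : ℕ∞) g V ∧ ∀ z ∈ U, g (h z) = z)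

/-- `h ∈ E⁺(F)`: an element of `E(F)` with positive Jacobian determinant at `O`. -/
def EplMem (Φ : TCFlow) (h : Pt → Pt) : Prop :=
  Emem Φ h ∧ 0 < LinearMap.det ((fderiv ℝ h ptO) : Pt →ₗ[ℝ] Pt)

/-- `h ∈ E^∂(F)`: an element of `E⁺(F)` fixed on the boundary circle. -/
def EbdMem (Φ : TCFlow) (h : Pt → Pt) : Prop :=
  EplMem Φ h ∧ ∀ z ∈ bdD, h z = z

/-- `h ∈ D(F)`: an element of `E(F)` which is a `C^∞` diffeomorphism of `D²` onto itself. -/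
def DmemTC (Φ : TCFlow) (h : Pt → Pt) : Prop :=
  Emem Φ h ∧ Set.BijOn h diskD diskD ∧
  ∃ g : Pt → Pt, ContDiffOn ℝ (⊤ : ℕ∞) g diskD ∧
    (∀ z ∈ diskD, g (h z) = z) ∧ (∀ z ∈ diskD, h (g z) = z)

/-- `h ∈ D⁺(F) = D(F) ∩ E⁺(F)`. -/
def DplMem (Φ : TCFlow) (h : Pt → Pt) : Prop := DmemTC Φ h ∧ EplMem Φ h

/-- `h ∈ D^∂(F) = D(F) ∩ E^∂(F)`. -/
def DbdMem (Φ : TCFlow) (h : Pt → Pt) : Prop := DmemTC Φ h ∧ EbdMem Φ h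

/-- `h ∈ Sh(F)`: `h` is the shift along orbits of `F` via some `C^∞` function
`α : D² → ℝ`. -/
def ShMem (Φ : TCFlow) (h : Pt → Pt) : Prop :=
  ∃ α : Pt → ℝ, ContDiffOn ℝ (⊤ : ℕ∞) α diskD ∧ ∀ z ∈ diskD, h z = Φ.φ z (α z)

/-- A first strong integral for a TC flow: a continuous function `f : D² → [0,1]`, `C^∞`
and without critical points on `D² ∖ {O}`, with `f⁻¹(0) = {O}`, `f⁻¹(1) = ∂D²`, and whose
level sets are exactly the orbits of the flow. -/
def FirstStrongIntegral (Φ : TCFlow) (f : Pt → ℝ) : Prop :=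
  ContinuousOn f diskD ∧
  Set.MapsTo f diskD (Icc (0 : ℝ) 1) ∧
  ContDiffOn ℝ (⊤ : ℕ∞) f (diskD \ {ptO}) ∧
  (∀ z ∈ diskD \ {ptO}, fderivWithin ℝ f (diskD \ {ptO}) z ≠ 0) ∧
  (∀ z ∈ diskD, (f z = 0 ↔ z = ptO)) ∧
  (∀ z ∈ diskD, (f z = 1 ↔ z ∈ bdD)) ∧
  (∀ c ∈ Icc (0 : ℝ) 1, ∃ z ∈ diskD, {w ∈ diskD | f w = c} = orb Φ z)

/-- `θ` is the minimal period function of the TC flow `Φ` on `D² ∖ {O}`. -/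
def IsMinPeriod (Φ : TCFlow) (θ : Pt → ℝ) : Prop :=
  ∀ z ∈ diskD \ {ptO},
    0 < θ z ∧ Φ.φ z (θ z) = z ∧ ∀ t : ℝ, 0 < t → t < θ z → Φ.φ z t ≠ z

section
open Filter Topology

theorem ift_deriv {E : Type*} [NormedAddCommGroup E] [NormedSpace ℝ E] {s : Set E}
    {G : E × ℝ → ℝ} {τ : E → ℝ} {w : E} {L : E × ℝ →L[ℝ] ℝ} (hw : w ∈ s)
    (hG : HasFDerivWithinAt G L (s ×ˢ univ) (w, τ w))
    (hτ : ContinuousWithinAt τ s w) (h0 : ∀ᶠ x in 𝓝[s] w, G (x, τ x) = 0) (hc : L (0, 1) ≠ 0) :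
    HasFDerivWithinAt τ (-(L (0, 1))⁻¹ • (L.comp (ContinuousLinearMap.inl ℝ E ℝ))) s w := by
  have hf : HasFDerivWithinAt (fun p : E × ℝ => (p.1, G p))
      ((ContinuousLinearMap.fst ℝ E ℝ).prod L) (s ×ˢ univ) (w, τ w) :=
    hasFDerivWithinAt_fst.prodMk hG
  have hh : HasFDerivWithinAt (fun x : E => (x, (0:ℝ))) (ContinuousLinearMap.inl ℝ E ℝ) s w :=
    (ContinuousLinearMap.inl ℝ E ℝ).hasFDerivWithinAt
  have hst : Tendsto (fun x => (x, τ x)) (𝓝[s] w) (𝓝[s ×ˢ univ] (w, τ w)) := by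
    rw [nhdsWithin_prod_eq, nhdsWithin_univ]
    exact tendsto_id.prodMk hτ
  have key := HasFDerivWithinAt.of_comp_of_leftInverse (g := fun x => (x, τ x))
    (f'symm := (ContinuousLinearMap.fst ℝ E ℝ).prod
      ((L (0, 1))⁻¹ • (ContinuousLinearMap.snd ℝ E ℝ - (L.comp (ContinuousLinearMap.inl ℝ E ℝ)).comp (ContinuousLinearMap.fst ℝ E ℝ))))
    hst hf hh (by filter_upwards [h0] with x hx; simp [hx]) ?_ hw
  · have := (ContinuousLinearMap.snd ℝ E ℝ).hasFDerivAt.comp_hasFDerivWithinAt w key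
    refine this.congr_fderiv ?_
    ext v
    simp
  · rintro ⟨a, b⟩
    have : L (a, b) = L (a, 0) + b * L (0, 1) := by
      rw [← smul_eq_mul, ← map_smul, ← map_add]; simp
    simp [this]
    field_simp

theorem ift_smooth {E : Type*} [NormedAddCommGroup E] [NormedSpace ℝ E] {s : Set E}
    (hs : UniqueDiffOn ℝ s)
    {G : E × ℝ → ℝ} {τ : E → ℝ}
    (hG : ContDiffOn ℝ (⊤ : ℕ∞) G (s ×ˢ univ))
    (hτ : ContinuousOn τ s) (h0 : ∀ x ∈ s, G (x, τ x) = 0)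
    (hc : ∀ x ∈ s, fderivWithin ℝ G (s ×ˢ univ) (x, τ x) (0, 1) ≠ 0) :
    ContDiffOn ℝ (⊤ : ℕ∞) τ s := by
  have hd : ∀ w ∈ s, HasFDerivWithinAt τ (-(fderivWithin ℝ G (s ×ˢ univ) (w, τ w) (0, 1))⁻¹ •
      ((fderivWithin ℝ G (s ×ˢ univ) (w, τ w)).comp (ContinuousLinearMap.inl ℝ E ℝ))) s w := by
    intro w hw
    refine ift_deriv hw ?_ (hτ w hw) (by filter_upwards [self_mem_nhdsWithin] with x hx using h0 x hx) (hc w hw)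
    exact ((hG.differentiableOn (by simp)) _ ⟨hw, mem_univ _⟩).hasFDerivWithinAt
  have hs2 : UniqueDiffOn ℝ (s ×ˢ (univ : Set ℝ)) := hs.prod uniqueDiffOn_univ
  have hD : ContDiffOn ℝ (⊤ : ℕ∞) (fderivWithin ℝ G (s ×ˢ univ)) (s ×ˢ univ) :=
    hG.fderivWithin hs2 (by simp)
  rw [contDiffOn_infty]
  intro n
  induction n with
  | zero => simpa using (contDiffOn_zero (𝕜 := ℝ)).2 hτ
  | succ n ih =>
    push_cast
    refine contDiffOn_succ_of_fderivWithin (fun w hw => (hd w hw).differentiableWithinAt) (by simp) ?_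
    have h1 : ContDiffOn ℝ n (fun w => fderivWithin ℝ G (s ×ˢ univ) (w, τ w)) s :=
      (hD.of_le (mod_cast le_top)).comp (contDiffOn_id.prodMk ih) (fun w hw => ⟨hw, mem_univ _⟩)
    have h2 : ContDiffOn ℝ n (fun w => fderivWithin ℝ G (s ×ˢ univ) (w, τ w) (0, 1)) s :=
      h1.clm_apply contDiffOn_const
    have h3 := (h2.inv hc).neg.smul (h1.clm_comp (contDiffOn_const (c := ContinuousLinearMap.inl ℝ E ℝ)))
    refine h3.congr (fun w hw => ?_)
    exact (hd w hw).fderivWithin (hs w hw)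

theorem int_const {X : Type*} [TopologicalSpace X] {s : Set X} (hs : IsPreconnected s)
    {f : X → ℝ} (hf : ContinuousOn f s) (hn : ∀ x ∈ s, ∃ n : ℤ, f x = n) :
    ∃ n : ℤ, ∀ x ∈ s, f x = n := by
  rcases s.eq_empty_or_nonempty with rfl | ⟨x0, hx0⟩
  · exact ⟨0, by simp⟩
  obtain ⟨n, hn0⟩ := hn x0 hx0
  refine ⟨n, fun x hx => ?_⟩
  rw [← hn0]
  have hdisc : IsDiscrete (range ((↑) : ℤ → ℝ)) := by
    constructor
    exact Int.isClosedEmbedding_coe_real.isEmbedding.toHomeomorph.symm.isEmbedding.discreteTopology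
  exact hs.constant_of_mapsTo (T := range ((↑) : ℤ → ℝ)) hdisc hf
    (fun y hy => by obtain ⟨m, hm⟩ := hn y hy; exact ⟨m, hm.symm⟩) hx hx0

theorem exp_const {X : Type*} [TopologicalSpace X] {s : Set X} (hs : IsPreconnected s)
    {f : X → ℂ} (hf : ContinuousOn f s) (hn : ∀ x ∈ s, Complex.exp (f x) = 1) :
    ∃ n : ℤ, ∀ x ∈ s, f x = n * (2 * Real.pi * Complex.I) := by
  have hn' : ∀ x ∈ s, ∃ n : ℤ, f x = n * (2 * Real.pi * Complex.I) := fun x hx =>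
    Complex.exp_eq_one_iff.1 (hn x hx)
  have hpi := Real.pi_ne_zero
  obtain ⟨n, h⟩ := int_const hs (f := fun x => (f x).im / (2 * Real.pi))
    ((Complex.continuous_im.comp_continuousOn hf).div_const _) (fun x hx => by
      obtain ⟨n, h⟩ := hn' x hx
      refine ⟨n, ?_⟩
      rw [h]; simp)
  refine ⟨n, fun x hx => ?_⟩
  obtain ⟨m, hm⟩ := hn' x hx
  have := h x hx
  rw [hm] at this
  have h2 : (m : ℝ) = n := by
    rw [← this]; simp
  have : m = n := by exact_mod_cast h2
  rw [hm, this]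

theorem exists_log {X : Type*} [TopologicalSpace X] [SimplyConnectedSpace X]
    [LocallyPathConnectedSpace X] {f : X → ℂ} (hf : Continuous f) (h0 : ∀ x, f x ≠ 0) :
    ∃ g : X → ℂ, Continuous g ∧ ∀ x, Complex.exp (g x) = f x := by
  have x0 : X := Classical.choice inferInstance
  obtain ⟨g, ⟨-, hg⟩, -⟩ := Complex.isCoveringMapOn_exp.existsUnique_continuousMap_lifts
    ⟨f, hf⟩ (Complex.exp_log (h0 x0)) (fun x => h0 x)
  exact ⟨g, g.continuous, fun x => congrFun hg x⟩

def cA : Set ℂ := {z | z ≠ 0 ∧ ‖z‖ ≤ 1}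

theorem log_A {f : ℂ → ℂ} (hf : ContinuousOn f cA) (h0 : ∀ z ∈ cA, f z ≠ 0) :
    ∃ (d : ℤ) (g : ℂ → ℂ), ContinuousOn g cA ∧ ∀ z ∈ cA, f z = z ^ d * Complex.exp (g z) := by
  set p : ℂ → ℂ := fun w => Complex.exp ((min w.re 0 : ℝ) + w.im * Complex.I) with hp
  have pc : Continuous p := by fun_prop
  have pA : ∀ w, p w ∈ cA := fun w => ⟨Complex.exp_ne_zero _, by
    simp [hp, Complex.norm_exp]⟩
  have pe : ∀ w : ℂ, w.re ≤ 0 → p w = Complex.exp w := fun w hw => by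
    simp only [hp, min_eq_left hw, Complex.re_add_im]
  obtain ⟨g, gc, hg⟩ := exists_log (f := f ∘ p) (hf.comp_continuous pc pA) (fun w => h0 _ (pA w))
  have pper : ∀ w, p (w + 2 * Real.pi * Complex.I) = p w := fun w => by
    simp only [hp]
    rw [Complex.exp_eq_exp_iff_exists_int]
    refine ⟨1, ?_⟩
    simp; ring
  obtain ⟨d, hd⟩ := exp_const (X := ℂ) isPreconnected_univ
    (f := fun w => g (w + 2 * Real.pi * Complex.I) - g w) (by fun_prop) (fun w _ => by
      rw [Complex.exp_sub, hg, hg]; simp only [Function.comp]; rw [pper]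
      exact div_self (h0 _ (pA w)))
  set G : ℂ → ℂ := fun w => g w - d * w with hG
  have Gc : Continuous G := by fun_prop
  have Gper : Function.Periodic G (2 * Real.pi * Complex.I) := fun w => by
    have := hd w (mem_univ _)
    simp only [hG]
    linear_combination this
  have Geq : ∀ w w', Complex.exp w = Complex.exp w' → G w = G w' := fun w w' h => by
    obtain ⟨n, rfl⟩ := Complex.exp_eq_exp_iff_exists_int.1 h
    exact Gper.int_mul n w'
  refine ⟨d, fun z => G (Complex.log z), fun z hz => ?_, fun z hz => ?_⟩
  · apply ContinuousAt.continuousWithinAt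
    by_cases hs : z ∈ Complex.slitPlane
    · exact Gc.continuousAt.comp (continuousAt_clog hs)
    · have hs' : -z ∈ Complex.slitPlane := by
        rw [Complex.mem_slitPlane_iff] at hs ⊢
        push Not at hs
        left
        have : z.re ≠ 0 := fun h => hz.1 (Complex.ext h hs.2)
        simp only [Complex.neg_re]
        have := lt_of_le_of_ne hs.1 this
        linarith
      have h1 : ContinuousAt (fun y => G (Complex.log (-y) + Real.pi * Complex.I)) z := by
        refine Gc.continuousAt.comp ?_
        refine ContinuousAt.add ?_ continuousAt_const
        exact (continuousAt_clog hs').comp continuous_neg.continuousAt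
      refine h1.congr ?_
      filter_upwards [isOpen_ne.mem_nhds hz.1] with y hy
      apply Geq
      rw [Complex.exp_add, Complex.exp_log (neg_ne_zero.2 hy), Complex.exp_log hy,
        Complex.exp_pi_mul_I]
      ring
  · have h1 : (Complex.log z).re ≤ 0 := by
      rw [Complex.log_re]; exact Real.log_nonpos (norm_nonneg _) hz.2
    have h2 := hg (Complex.log z)
    simp only [Function.comp] at h2
    rw [pe _ h1, Complex.exp_log hz.1] at h2
    simp only [hG]
    rw [Complex.exp_sub, h2, Complex.exp_int_mul, Complex.exp_log hz.1]
    have := zpow_ne_zero d hz.1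
    field_simp

end

section
open Filter Topology

def dA : Set Pt := diskD \ {ptO}
def oD : Set Pt := {p | p.1 ^ 2 + p.2 ^ 2 < 1}

theorem oD_open : IsOpen oD := isOpen_lt (by fun_prop) (by fun_prop)
theorem oD_sub : oD ⊆ diskD := fun p hp => by simp only [oD, diskD, mem_ofPred_eq] at *; exact le_of_lt hp
theorem O_oD : ptO ∈ oD := by simp [oD, ptO]
theorem O_disk : ptO ∈ diskD := oD_sub O_oD
theorem disk_nhds {z : Pt} (hz : z ∈ oD) : diskD ∈ 𝓝 z := mem_of_superset (oD_open.mem_nhds hz) oD_sub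

theorem disk_convex : Convex ℝ diskD := by
  intro x hx y hy a b ha hb hab
  simp only [diskD, mem_ofPred_eq, Prod.fst_add, Prod.snd_add, Prod.smul_fst, Prod.smul_snd, smul_eq_mul] at *
  have hb' : b = 1 - a := by linarith
  subst hb'
  nlinarith [mul_nonneg ha hb, mul_nonneg (mul_nonneg ha hb) (add_nonneg (sq_nonneg (x.1 - y.1)) (sq_nonneg (x.2 - y.2))), mul_le_mul_of_nonneg_left hx ha, mul_le_mul_of_nonneg_left hy hb]

theorem disk_ud : UniqueDiffOn ℝ diskD :=
  uniqueDiffOn_convex disk_convex ⟨ptO, interior_mono oD_sub (by rw [oD_open.interior_eq]; exact O_oD)⟩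

theorem dA_ud : UniqueDiffOn ℝ dA := disk_ud.inter isOpen_compl_singleton

variable (Φ : TCFlow)

theorem phi_cont : ContinuousOn (fun p : Pt × ℝ => Φ.φ p.1 p.2) (diskD ×ˢ univ) :=
  Φ.φ_smooth.continuousOn

theorem phi_tendsto {ι : Type*} {l : Filter ι} {f : ι → Pt} {g : ι → ℝ} {z : Pt} {t : ℝ}
    (hz : z ∈ diskD) (hf : Tendsto f l (𝓝[diskD] z)) (hg : Tendsto g l (𝓝 t)) :
    Tendsto (fun i => Φ.φ (f i) (g i)) l (𝓝[diskD] (Φ.φ z t)) := by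
  rw [tendsto_nhdsWithin_iff] at hf ⊢
  refine ⟨?_, hf.2.mono fun i hi => Φ.φ_mapsTo _ hi _⟩
  have h1 : Tendsto (fun i => (f i, g i)) l (𝓝[diskD ×ˢ univ] (z, t)) := by
    rw [tendsto_nhdsWithin_iff]
    exact ⟨hf.1.prodMk_nhds hg, hf.2.mono fun i hi => ⟨hi, mem_univ _⟩⟩
  exact ((phi_cont Φ) (z, t) ⟨hz, mem_univ _⟩).tendsto.comp h1

theorem phi_neg {z : Pt} (hz : z ∈ diskD) (t : ℝ) : Φ.φ (Φ.φ z t) (-t) = z := by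
  rw [Φ.φ_add z hz, add_neg_cancel, Φ.φ_zero z hz]

theorem phi_neg' {z : Pt} (hz : z ∈ diskD) (t : ℝ) : Φ.φ (Φ.φ z (-t)) t = z := by
  rw [Φ.φ_add z hz, neg_add_cancel, Φ.φ_zero z hz]

theorem phi_bd {z : Pt} (hz : z ∈ bdD) (t : ℝ) : Φ.φ z t ∈ bdD := by
  rw [← Φ.bd_orbit z hz]; exact ⟨t, rfl⟩

theorem disk_cases {z : Pt} (hz : z ∈ diskD) : z ∈ oD ∨ z ∈ bdD := by simp only [oD, diskD, bdD, mem_ofPred_eq] at *; exact lt_or_eq_of_le hz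

theorem not_both {z : Pt} (hz : z ∈ oD) (h : z ∈ bdD) : False := by
  simp only [oD, bdD, mem_ofPred_eq] at *; linarith

theorem bd_disk {z : Pt} (hz : z ∈ bdD) : z ∈ diskD := by
  simp only [diskD, bdD, mem_ofPred_eq] at *; exact le_of_eq hz

theorem phi_oD {z : Pt} (hz : z ∈ oD) (t : ℝ) : Φ.φ z t ∈ oD := by
  rcases disk_cases (Φ.φ_mapsTo z (oD_sub hz) t) with h | h
  · exact h
  · exfalso
    have := phi_bd Φ h (-t)
    rw [phi_neg Φ (oD_sub hz)] at this
    exact not_both hz this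

theorem phi_fd {z : Pt} (hz : z ∈ oD) (t : ℝ) :
    HasFDerivAt (fun w => Φ.φ w t) ((fderiv ℝ (fun p : Pt × ℝ => Φ.φ p.1 p.2) (z, t)).comp
      (ContinuousLinearMap.inl ℝ Pt ℝ)) z := by
  have h1 : HasFDerivAt (fun p : Pt × ℝ => Φ.φ p.1 p.2) (fderiv ℝ (fun p : Pt × ℝ => Φ.φ p.1 p.2) (z, t)) (z, t) := by
    apply DifferentiableAt.hasFDerivAt
    refine ((Φ.φ_smooth.differentiableOn (by simp)) (z, t) ⟨oD_sub hz, mem_univ _⟩).differentiableAt ?_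
    exact prod_mem_nhds (disk_nhds hz) univ_mem
  exact HasFDerivAt.comp (f := fun w : Pt => (w, t)) z h1 (hasFDerivAt_prodMk_left z t)

theorem phi_fd_F {z : Pt} (hz : z ∈ diskD) {t : ℝ} {L : Pt →L[ℝ] Pt}
    (hL : HasFDerivAt (fun w => Φ.φ w t) L z) : L (Φ.F z) = Φ.F (Φ.φ z t) := by
  have h1 : HasDerivAt (fun s => Φ.φ (Φ.φ z s) t) (L (Φ.F z)) 0 := by
    have h0 := Φ.φ_deriv z hz 0
    rw [Φ.φ_zero z hz] at h0
    have hL' : HasFDerivAt (fun w => Φ.φ w t) L (Φ.φ z 0) := by rwa [Φ.φ_zero z hz]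
    exact hL'.comp_hasDerivAt (0:ℝ) h0
  have h2 : HasDerivAt (fun s => Φ.φ (Φ.φ z s) t) (Φ.F (Φ.φ z t)) 0 := by
    have h0 := Φ.φ_deriv z hz (0 + t)
    have := HasDerivAt.comp_add_const (0:ℝ) t h0
    rw [zero_add] at this
    refine this.congr_of_eventuallyEq (Eventually.of_forall fun s => ?_)
    exact Φ.φ_add z hz s t
  exact h1.unique h2

theorem phi_O (t : ℝ) : Φ.φ ptO t = ptO := by
  have hF : Φ.F ptO = 0 := (Φ.F_zero_iff _ O_disk).2 rfl
  have h1 : ∀ t, HasDerivAt (Φ.φ ptO) 0 t := fun t => by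
    have := phi_fd_F Φ O_disk (phi_fd Φ O_oD t)
    rw [hF, map_zero] at this
    rw [this]; exact Φ.φ_deriv _ O_disk t
  have := is_const_of_deriv_eq_zero (fun t => (h1 t).differentiableAt) (fun t => (h1 t).deriv) t 0
  rw [this, Φ.φ_zero _ O_disk]

theorem phi_dA {z : Pt} (hz : z ∈ dA) (t : ℝ) : Φ.φ z t ∈ dA := by
  refine ⟨Φ.φ_mapsTo z hz.1 t, fun h => hz.2 ?_⟩
  have := phi_neg Φ hz.1 t
  rw [mem_singleton_iff] at h
  rw [h, phi_O] at this
  exact this.symm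

theorem phi_det {z : Pt} (hz : z ∈ oD) (t : ℝ) :
    0 < LinearMap.det (((fderiv ℝ (fun p : Pt × ℝ => Φ.φ p.1 p.2) (z, t)).comp
      (ContinuousLinearMap.inl ℝ Pt ℝ) : Pt →L[ℝ] Pt) : Pt →ₗ[ℝ] Pt) := by
  set D : ℝ → ℝ := fun t => ContinuousLinearMap.det ((fderiv ℝ (fun p : Pt × ℝ => Φ.φ p.1 p.2) (z, t)).comp
      (ContinuousLinearMap.inl ℝ Pt ℝ) : Pt →L[ℝ] Pt) with hD
  have Dc : Continuous D := by
    refine ContinuousLinearMap.continuous_det.comp ?_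
    refine Continuous.clm_comp ?_ continuous_const
    have h1 : ContDiffOn ℝ (⊤ : ℕ∞) (fun p : Pt × ℝ => Φ.φ p.1 p.2) (oD ×ˢ univ) :=
      Φ.φ_smooth.mono (prod_mono oD_sub subset_rfl)
    have h2 := h1.continuousOn_fderiv_of_isOpen (oD_open.prod isOpen_univ) (by simp)
    exact h2.comp_continuous (by fun_prop) (fun t => ⟨hz, mem_univ _⟩)
  have D0 : D 0 = 1 := by
    have h1 := phi_fd Φ hz 0
    have h2 : HasFDerivAt (fun w => Φ.φ w 0) (ContinuousLinearMap.id ℝ Pt) z := by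
      refine (hasFDerivAt_id z).congr_of_eventuallyEq ?_
      filter_upwards [disk_nhds hz] with w hw using Φ.φ_zero w hw
    simp only [hD]
    rw [h1.unique h2]
    simp [ContinuousLinearMap.det]
  have Dne : ∀ t, D t ≠ 0 := fun t => by
    have h1 := phi_fd Φ hz t
    have h2 := phi_fd Φ (phi_oD Φ hz t) (-t)
    have h3 := h2.comp z h1
    have h4 : HasFDerivAt ((fun w => Φ.φ w (-t)) ∘ fun w => Φ.φ w t) (ContinuousLinearMap.id ℝ Pt) z := by
      refine (hasFDerivAt_id z).congr_of_eventuallyEq ?_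
      filter_upwards [disk_nhds hz] with w hw using phi_neg Φ hw t
    have h5 := h3.unique h4
    have h6 := congrArg ContinuousLinearMap.det h5
    simp only [ContinuousLinearMap.det, ContinuousLinearMap.toLinearMap_comp, LinearMap.det_comp] at h6
    intro h
    simp only [hD, ContinuousLinearMap.det, ContinuousLinearMap.toLinearMap_comp] at h
    rw [h, mul_zero] at h6
    exact zero_ne_one (h6.trans LinearMap.det_id)
  change 0 < D t
  by_contra hneg
  push Not at hneg
  have : (0:ℝ) ∈ D '' univ := by
    refine (isPreconnected_univ.image D Dc.continuousOn).ordConnected.out (mem_image_of_mem D (mem_univ t)) (mem_image_of_mem D (mem_univ 0)) ⟨hneg, by rw [D0]; norm_num⟩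
  obtain ⟨s, -, hs⟩ := this
  exact Dne s hs

variable {Φ} {θ : Pt → ℝ}

theorem per_le (hθ : IsMinPeriod Φ θ) {z : Pt} (hz : z ∈ dA) {t : ℝ} (ht : 0 < t) (h : Φ.φ z t = z) : θ z ≤ t := by
  by_contra hlt
  push Not at hlt
  exact (hθ z hz).2.2 t ht hlt h

theorem per_zmul (hθ : IsMinPeriod Φ θ) {z : Pt} (hz : z ∈ dA) (n : ℤ) (t : ℝ) : Φ.φ z (t + n * θ z) = Φ.φ z t := by
  have hp : Function.Periodic (Φ.φ z) (θ z) := fun t => by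
    rw [add_comm, ← Φ.φ_add z hz.1, (hθ z hz).2.1]
  exact hp.int_mul n t

theorem per_iff (hθ : IsMinPeriod Φ θ) {z : Pt} (hz : z ∈ dA) {s t : ℝ} (h : Φ.φ z s = Φ.φ z t) : ∃ n : ℤ, s = t + n * θ z := by
  have h0 := (hθ z hz).1
  have h1 : Φ.φ z (s - t) = z := by
    have := congrArg (fun p => Φ.φ p (-t)) h
    simp only [Φ.φ_add z hz.1] at this
    rw [add_neg_cancel, Φ.φ_zero z hz.1] at this
    exact this
  set n := ⌊(s - t) / θ z⌋ with hn
  refine ⟨n, ?_⟩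
  have h2 : Φ.φ z (s - t - n * θ z) = z := by
    have := per_zmul hθ hz (-n) (s - t)
    rw [h1] at this
    push_cast at this
    rwa [neg_mul, ← sub_eq_add_neg] at this
  have h3 : (n:ℝ) ≤ (s - t) / θ z := Int.floor_le _
  have h4 : (s - t) / θ z < n + 1 := Int.lt_floor_add_one _
  rw [le_div_iff₀ h0] at h3
  rw [div_lt_iff₀ h0] at h4
  by_contra hne
  have h5 : 0 < s - t - n * θ z := lt_of_le_of_ne (by linarith) (fun h => hne (by linarith))
  have := per_le hθ hz h5 h2
  linarith

theorem per_orb_le (hθ : IsMinPeriod Φ θ) {z : Pt} (hz : z ∈ dA) (t : ℝ) : θ (Φ.φ z t) ≤ θ z := by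
  refine per_le hθ (phi_dA Φ hz t) (hθ z hz).1 ?_
  rw [Φ.φ_add z hz.1]
  simpa using per_zmul hθ hz 1 t

theorem per_orb (hθ : IsMinPeriod Φ θ) {z : Pt} (hz : z ∈ dA) (t : ℝ) : θ (Φ.φ z t) = θ z := by
  refine le_antisymm (per_orb_le hθ hz t) ?_
  have := per_orb_le hθ (phi_dA Φ hz t) (-t)
  rwa [phi_neg Φ hz.1] at this

end

section
open Filter Topology

def dt (a b : Pt) : ℝ := a.1 * b.1 + a.2 * b.2

theorem dt_cont : Continuous (fun p : Pt × Pt => dt p.1 p.2) := by unfold dt; fun_prop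

theorem dt_pos {a : Pt} (h : a ≠ 0) : 0 < dt a a := by
  have : a.1 ≠ 0 ∨ a.2 ≠ 0 := by
    by_contra hh; push Not at hh; exact h (Prod.ext hh.1 hh.2)
  unfold dt
  rcases this with h | h
  · have := mul_self_pos.2 h; nlinarith [mul_self_nonneg a.2]
  · have := mul_self_pos.2 h; nlinarith [mul_self_nonneg a.1]

theorem line {N v p z : Pt} (hN : N ≠ 0) (hv : v ≠ 0) (h : dt v N = 0) (hp : dt (p - z) N = 0) :
    p = z + (dt (p - z) v / dt v v) • v := by
  have h1 := dt_pos hN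
  have h2 := dt_pos hv
  obtain ⟨n1, n2⟩ := N
  obtain ⟨v1, v2⟩ := v
  obtain ⟨p1, p2⟩ := p
  obtain ⟨z1, z2⟩ := z
  simp only [dt, Prod.mk_sub_mk] at *
  -- v1*(p2-z2) = v2*(p1-z1)
  have key : v1 * (p2 - z2) = v2 * (p1 - z1) := by
    have e1 : (v1 * (p2 - z2) - v2 * (p1 - z1)) * n1 = 0 := by linear_combination (p2 - z2) * h - v2 * hp
    have e2 : (v1 * (p2 - z2) - v2 * (p1 - z1)) * n2 = 0 := by linear_combination (-(p1 - z1)) * h + v1 * hp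
    have e3 : (v1 * (p2 - z2) - v2 * (p1 - z1)) * (n1 * n1 + n2 * n2) = 0 := by linear_combination n1 * e1 + n2 * e2
    rcases mul_eq_zero.1 e3 with h | h <;> linarith
  have hne := h2.ne'
  ext
  · simp only [Prod.smul_mk, smul_eq_mul, Prod.mk_add_mk]
    rw [← sub_eq_iff_eq_add', div_mul_eq_mul_div, eq_div_iff hne]
    linear_combination (-v2) * key
  · simp only [Prod.smul_mk, smul_eq_mul, Prod.mk_add_mk]
    rw [← sub_eq_iff_eq_add', div_mul_eq_mul_div, eq_div_iff hne]
    linear_combination (v1) * key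

variable (Φ : TCFlow)

theorem g_deriv {z N w : Pt} (hw : w ∈ diskD) (t : ℝ) :
    HasDerivAt (fun t => dt (Φ.φ w t - z) N) (dt (Φ.F (Φ.φ w t)) N) t := by
  have h := Φ.φ_deriv w hw t
  have h1 : HasDerivAt (fun t => (Φ.φ w t).1) (Φ.F (Φ.φ w t)).1 t := ((ContinuousLinearMap.fst ℝ ℝ ℝ).hasFDerivAt.comp_hasDerivAt t h)
  have h2 : HasDerivAt (fun t => (Φ.φ w t).2) (Φ.F (Φ.φ w t)).2 t := ((ContinuousLinearMap.snd ℝ ℝ ℝ).hasFDerivAt.comp_hasDerivAt t h)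
  exact ((h1.sub_const z.1).mul_const N.1).add ((h2.sub_const z.2).mul_const N.2)

structure FB (z : Pt) where
  η : ℝ
  U : Set Pt
  s : Pt → ℝ
  hη : 0 < η
  hU : IsOpen U
  hz : z ∈ U
  mem : ∀ w ∈ diskD ∩ U, s w ∈ Icc (-(η / 2)) (η / 2)
  zero : ∀ w ∈ diskD ∩ U, dt (Φ.φ w (s w) - z) (Φ.F z) = 0
  pos : ∀ w ∈ diskD ∩ U, ∀ t ∈ Icc (-η) η, 0 < dt (Φ.F (Φ.φ w t)) (Φ.F z)
  mono : ∀ w ∈ diskD ∩ U, StrictMonoOn (fun t => dt (Φ.φ w t - z) (Φ.F z)) (Icc (-η) η)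
  cont : ContinuousOn s (diskD ∩ U)

theorem flowbox {z : Pt} (hz : z ∈ dA) : Nonempty (FB Φ z) := by
  set N := Φ.F z with hN
  have hN0 : N ≠ 0 := fun h => hz.2 ((Φ.F_zero_iff z hz.1).1 h)
  have hNN := dt_pos hN0
  have E1 : ∀ᶠ p : Pt × ℝ in (𝓝[diskD] z) ×ˢ 𝓝 0, 0 < dt (Φ.F (Φ.φ p.1 p.2)) N := by
    have h1 : Tendsto (fun p : Pt × ℝ => Φ.φ p.1 p.2) ((𝓝[diskD] z) ×ˢ 𝓝 0) (𝓝[diskD] z) := by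
      have := phi_tendsto Φ hz.1 (tendsto_fst (f := 𝓝[diskD] z) (g := 𝓝 (0:ℝ))) tendsto_snd
      rwa [Φ.φ_zero z hz.1] at this
    have h2 : Tendsto (fun p : Pt × ℝ => Φ.F (Φ.φ p.1 p.2)) ((𝓝[diskD] z) ×ˢ 𝓝 0) (𝓝 N) :=
      (Φ.F_smooth.continuousOn z hz.1).tendsto.comp h1
    have h3 : Tendsto (fun p : Pt × ℝ => dt (Φ.F (Φ.φ p.1 p.2)) N) ((𝓝[diskD] z) ×ˢ 𝓝 0) (𝓝 (dt N N)) :=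
      (dt_cont.tendsto (N, N)).comp (h2.prodMk_nhds tendsto_const_nhds)
    exact h3.eventually (lt_mem_nhds hNN)
  obtain ⟨pa, hpa, pb, hpb, hp⟩ := eventually_prod_iff.1 E1
  obtain ⟨ε, hε, hb⟩ := Metric.eventually_nhds_iff.1 hpb
  set η := ε / 2 with hηd
  have hη : 0 < η := by positivity
  have hpos : ∀ w, pa w → ∀ t ∈ Icc (-η) η, 0 < dt (Φ.F (Φ.φ w t)) N := fun w hw t ht =>
    hp hw (hb (by rw [Real.dist_eq, sub_zero]; exact lt_of_le_of_lt (abs_le.2 ht) (by linarith)))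
  have hmono : ∀ w ∈ diskD, pa w → StrictMonoOn (fun t => dt (Φ.φ w t - z) N) (Icc (-η) η) := by
    intro w hwD hw
    refine strictMonoOn_of_deriv_pos (convex_Icc _ _)
      (fun t _ => (g_deriv Φ hwD t).continuousAt.continuousWithinAt) (fun t ht => ?_)
    rw [(g_deriv Φ hwD t).deriv]
    exact hpos w hw t (interior_subset ht)
  have hpz : pa z := hpa.self_of_nhdsWithin hz.1
  have gz : dt (Φ.φ z 0 - z) N = 0 := by rw [Φ.φ_zero z hz.1]; simp [dt]
  have m0 : (0:ℝ) ∈ Icc (-η) η := ⟨by linarith, by linarith⟩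
  have mp : (η/2) ∈ Icc (-η) η := ⟨by linarith, by linarith⟩
  have mm : -(η/2) ∈ Icc (-η) η := ⟨by linarith, by linarith⟩
  have hgt : ∀ t, Tendsto (fun w => dt (Φ.φ w t - z) N) (𝓝[diskD] z) (𝓝 (dt (Φ.φ z t - z) N)) := fun t => by
    have h1 := (phi_tendsto Φ hz.1 (tendsto_id (x := 𝓝[diskD] z)) (tendsto_const_nhds (x := t))).mono_right nhdsWithin_le_nhds
    exact (dt_cont.tendsto (_, N)).comp ((h1.sub_const z).prodMk_nhds tendsto_const_nhds)
  have Ep : ∀ᶠ w in 𝓝[diskD] z, 0 < dt (Φ.φ w (η/2) - z) N := by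
    refine (hgt (η/2)).eventually (lt_mem_nhds ?_)
    have := hmono z hz.1 hpz m0 mp (by linarith)
    simp only [gz] at this; exact this
  have Em : ∀ᶠ w in 𝓝[diskD] z, dt (Φ.φ w (-(η/2)) - z) N < 0 := by
    refine (hgt (-(η/2))).eventually (gt_mem_nhds ?_)
    have := hmono z hz.1 hpz mm m0 (by linarith)
    simp only [gz] at this; exact this
  obtain ⟨U, hU, hzU, hsub⟩ := mem_nhdsWithin.1 (hpa.and (Ep.and Em))
  have hex : ∀ w, ∃ s : ℝ, w ∈ diskD ∩ U → s ∈ Icc (-(η/2)) (η/2) ∧ dt (Φ.φ w s - z) N = 0 := by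
    intro w
    by_cases hw : w ∈ diskD ∩ U
    · obtain ⟨h1, h2, h3⟩ := hsub ⟨hw.2, hw.1⟩
      have hc : ContinuousOn (fun t => dt (Φ.φ w t - z) N) (Icc (-(η/2)) (η/2)) :=
        fun t _ => (g_deriv Φ hw.1 t).continuousAt.continuousWithinAt
      obtain ⟨s, hs, hs0⟩ := intermediate_value_Icc (by linarith) hc ⟨h3.le, h2.le⟩
      exact ⟨s, fun _ => ⟨hs, hs0⟩⟩
    · exact ⟨0, fun h => absurd h hw⟩
  choose s hs using hex
  have hsubI : Icc (-(η/2)) (η/2) ⊆ Icc (-η) η := Icc_subset_Icc (by linarith) (by linarith)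
  have hpaU : ∀ w ∈ diskD ∩ U, pa w := fun w hw => (hsub ⟨hw.2, hw.1⟩).1
  refine ⟨⟨η, U, s, hη, hU, hzU, fun w hw => (hs w hw).1, fun w hw => (hs w hw).2,
    fun w hw => hpos w (hpaU w hw), fun w hw => hmono w hw.1 (hpaU w hw), ?_⟩⟩
  intro w hw
  refine isCompact_Icc.tendsto_nhds_of_unique_mapClusterPt (s := Icc (-(η/2)) (η/2)) ?_ ?_
  · filter_upwards [self_mem_nhdsWithin] with y hy using (hs y hy).1
  · intro t ht hcl
    obtain ⟨𝒰, hle, htend⟩ := mapClusterPt_iff_ultrafilter.1 hcl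
    have h1 : Tendsto id (𝒰 : Filter Pt) (𝓝[diskD] w) := hle.trans (nhdsWithin_mono _ inter_subset_left)
    have h2 := (phi_tendsto Φ hw.1 h1 htend).mono_right nhdsWithin_le_nhds
    have h3 := (dt_cont.tendsto (Φ.φ w t - z, N)).comp ((h2.sub_const z).prodMk_nhds (tendsto_const_nhds (x := N)))
    have h4 : Tendsto (fun _ : Pt => (0:ℝ)) (𝒰 : Filter Pt) (𝓝 (dt (Φ.φ w t - z) N)) := by
      refine h3.congr' ?_
      have : ∀ᶠ y in (𝒰 : Filter Pt), y ∈ diskD ∩ U := hle self_mem_nhdsWithin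
      filter_upwards [this] with y hy using (hs y hy).2
    have h5 := tendsto_nhds_unique h4 tendsto_const_nhds
    exact (hmono w hw.1 (hpaU w hw)).injOn (hsubI ht) (hsubI (hs w hw).1) (h5.trans (hs w hw).2.symm)

variable {Φ}

theorem FB.uniq {z : Pt} (B : FB Φ z) {w : Pt} (hw : w ∈ diskD ∩ B.U) {t : ℝ} (ht : t ∈ Icc (-B.η) B.η)
    (h : dt (Φ.φ w t - z) (Φ.F z) = 0) : t = B.s w := by
  have hη := B.hη
  refine (B.mono w hw).injOn ht ?_ (h.trans (B.zero w hw).symm)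
  exact Icc_subset_Icc (by linarith) (by linarith) (B.mem w hw)

theorem FB.s_line {z : Pt} (B : FB Φ z) {w : Pt} (hw : w ∈ diskD ∩ B.U)
    (h : dt (w - z) (Φ.F z) = 0) : B.s w = 0 := by
  have hη := B.hη
  exact (B.uniq hw ⟨by linarith, by linarith⟩ (by rwa [Φ.φ_zero w hw.1])).symm

theorem FB.s_z {z : Pt} (B : FB Φ z) (hz : z ∈ dA) : B.s z = 0 :=
  B.s_line ⟨hz.1, B.hz⟩ (by simp [dt])

theorem FB.tendsto {z : Pt} (B : FB Φ z) (hz : z ∈ dA) : Tendsto B.s (𝓝[diskD] z) (𝓝 0) := by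
  have := B.cont z ⟨hz.1, B.hz⟩
  rw [ContinuousWithinAt, B.s_z hz, nhdsWithin_inter_of_mem' (mem_nhdsWithin_of_mem_nhds (B.hU.mem_nhds B.hz))] at this
  exact this

end

section
open Filter Topology

variable {Φ : TCFlow} {θ : Pt → ℝ}

/-- orbit hits the segment finitely often -/
theorem finite_hits {z v w : Pt} (B : FB Φ z) (hN : Φ.F z ≠ 0) (hvN : dt v (Φ.F z) = 0) {δ : ℝ}
    (hδ : ∀ x ∈ Icc 0 δ, z + x • v ∈ diskD ∩ B.U) (hw : w ∈ dA) :
    ((fun x : ℝ => z + x • v) '' (Icc 0 δ) ∩ range (Φ.φ w)).Finite := by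
  obtain ⟨T, hT, hTw⟩ := Φ.periodic w hw.1 hw.2
  set Z : Set ℝ := {t ∈ Icc 0 T | Φ.φ w t ∈ (fun x : ℝ => z + x • v) '' (Icc 0 δ)} with hZ
  have hη := B.hη
  have φc : Continuous (Φ.φ w) := continuous_iff_continuousAt.2 fun t => (Φ.φ_deriv w hw.1 t).continuousAt
  have hZf : Z.Finite := by
    by_contra hinf
    obtain ⟨t, htI, hacc⟩ := Set.Infinite.exists_accPt_of_subset_isCompact hinf isCompact_Icc (sep_subset _ _)
    have hcl : IsClosed Z := by
      have e : Z = Icc 0 T ∩ (Φ.φ w) ⁻¹' ((fun x : ℝ => z + x • v) '' (Icc 0 δ)) := by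
        ext t; simp only [hZ, mem_sep_iff, mem_inter_iff, mem_preimage]
      rw [e]
      refine isClosed_Icc.inter (IsClosed.preimage φc ?_)
      exact (isCompact_Icc.image (by fun_prop)).isClosed
    have htZ : t ∈ Z := hcl.closure_eq ▸ hacc.clusterPt.mem_closure
    obtain ⟨-, x, hx, hxt⟩ := htZ
    have hpos : 0 < dt (Φ.F (Φ.φ w t)) (Φ.F z) := by
      have := B.pos _ (hδ x hx) 0 ⟨by linarith, by linarith⟩
      rw [Φ.φ_zero _ (hδ x hx).1] at this
      rw [← hxt]; exact this
    have hne := (g_deriv Φ (z := z) (N := Φ.F z) hw.1 t).eventually_ne hpos.ne' (c := 0)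
    have hfr := accPt_iff_frequently_nhdsNE.1 hacc
    obtain ⟨y, hyZ, hy⟩ := (hfr.and_eventually hne).exists
    obtain ⟨-, x', hx', hxt'⟩ := hyZ
    apply hy
    rw [← hxt']
    have : dt (z + x' • v - z) (Φ.F z) = x' * dt v (Φ.F z) := by simp [dt]; ring
    simp only [this, hvN, mul_zero]
  refine (hZf.image (Φ.φ w)).subset ?_
  rintro p ⟨hp, t, rfl⟩
  have hper : Function.Periodic (Φ.φ w) T := fun t => by
    rw [add_comm, ← Φ.φ_add w hw.1, hTw]
  obtain ⟨y, hy, hyt⟩ := hper.exists_mem_Ico₀ hT t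
  rw [hyt] at hp ⊢
  exact ⟨y, ⟨⟨hy.1, hy.2.le⟩, hp⟩, rfl⟩

theorem one_side {z v : Pt} (hz : z ∈ dA) (B : FB Φ z) {T : ℝ} (hT : Φ.φ z T = z) (hv : v ≠ 0)
    (hvN : dt v (Φ.F z) = 0) (hD : ∀ᶠ x : ℝ in 𝓝[≥] 0, z + x • v ∈ diskD)
    (hpos : ∀ᶠ x : ℝ in 𝓝[>] 0, 0 ≤ dt (Φ.φ (Φ.φ (z + x • v) T) (B.s (Φ.φ (z + x • v) T)) - z) v) :
    ∀ᶠ x : ℝ in 𝓝[≥] 0, Φ.φ (Φ.φ (z + x • v) T) (B.s (Φ.φ (z + x • v) T)) = z + x • v := by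
  have hN : Φ.F z ≠ 0 := fun h => hz.2 ((Φ.F_zero_iff z hz.1).1 h)
  have hvv := dt_pos hv
  set γ : ℝ → Pt := fun x => z + x • v with hγ
  have γ0 : γ 0 = z := by simp [hγ]
  have γc : Continuous γ := by fun_prop
  have hγt : Tendsto γ (𝓝[≥] 0) (𝓝[diskD] z) := by
    rw [tendsto_nhdsWithin_iff]
    refine ⟨?_, hD⟩
    have := γc.tendsto 0
    rw [γ0] at this
    exact this.mono_left nhdsWithin_le_nhds
  have hγt2 : Tendsto (fun x => Φ.φ (γ x) T) (𝓝[≥] 0) (𝓝[diskD] z) := by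
    have := phi_tendsto Φ hz.1 hγt (tendsto_const_nhds (x := T))
    rwa [hT] at this
  have hWn : diskD ∩ B.U ∈ 𝓝[diskD] z := inter_mem self_mem_nhdsWithin (mem_nhdsWithin_of_mem_nhds (B.hU.mem_nhds B.hz))
  have hall := (hγt.eventually hWn).and (hγt2.eventually hWn)
  have hpos' : ∀ᶠ x : ℝ in 𝓝[≥] 0, 0 < x → 0 ≤ dt (Φ.φ (Φ.φ (γ x) T) (B.s (Φ.φ (γ x) T)) - z) v := by
    rw [eventually_nhdsWithin_iff] at hpos ⊢
    filter_upwards [hpos] with x h1 _ h2 using h1 h2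
  obtain ⟨δ, hδ, hsub⟩ := mem_nhdsGE_iff_exists_Icc_subset.1 (hall.and hpos')
  replace hδ : 0 < δ := hδ
  have hW1 : ∀ x ∈ Icc 0 δ, γ x ∈ diskD ∩ B.U := fun x hx => (hsub hx).1.1
  have hW2 : ∀ x ∈ Icc 0 δ, Φ.φ (γ x) T ∈ diskD ∩ B.U := fun x hx => (hsub hx).1.2
  set κ : ℝ → Pt := fun x => Φ.φ (Φ.φ (γ x) T) (B.s (Φ.φ (γ x) T)) with hκ
  set P : ℝ → ℝ := fun x => dt (κ x - z) v / dt v v with hP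
  have κP : ∀ x ∈ Icc 0 δ, κ x = γ (P x) := fun x hx => line hN hv hvN (B.zero _ (hW2 x hx))
  have γg : ∀ x, dt (γ x - z) (Φ.F z) = 0 := fun x => by
    have : dt (γ x - z) (Φ.F z) = x * dt v (Φ.F z) := by simp [dt, hγ]; ring
    rw [this, hvN, mul_zero]
  have γP : ∀ x, dt (γ x - z) v / dt v v = x := fun x => by
    have : dt (γ x - z) v = x * dt v v := by simp [dt, hγ]; ring
    rw [this]; field_simp
  have γinj : Function.Injective γ := fun x y h => by rw [← γP x, h, γP]
  have κφ : ∀ x ∈ Icc 0 δ, κ x = Φ.φ (γ x) (T + B.s (Φ.φ (γ x) T)) := fun x hx => by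
    simp only [hκ]; rw [Φ.φ_add _ (hW1 x hx).1]
  have φTc : ContinuousOn (fun x => Φ.φ (γ x) T) (Icc 0 δ) :=
    (phi_cont Φ).comp (f := fun x => (γ x, T)) (by fun_prop) (fun x hx => ⟨(hW1 x hx).1, mem_univ _⟩)
  have κc : ContinuousOn κ (Icc 0 δ) :=
    (phi_cont Φ).comp (f := fun x => (Φ.φ (γ x) T, B.s (Φ.φ (γ x) T)))
      (φTc.prodMk (B.cont.comp φTc hW2)) (fun x hx => ⟨(hW2 x hx).1, mem_univ _⟩)
  have Pc : ContinuousOn P (Icc 0 δ) := by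
    refine ContinuousOn.div_const ?_ _
    exact dt_cont.comp_continuousOn ((κc.sub continuousOn_const).prodMk continuousOn_const)
  have Pinj : InjOn P (Icc 0 δ) := by
    intro x hx y hy hxy
    have h1 : κ x = κ y := by rw [κP x hx, κP y hy, hxy]
    rw [κφ x hx, κφ y hy] at h1
    set a := B.s (Φ.φ (γ x) T)
    set b := B.s (Φ.φ (γ y) T)
    have ha := B.mem _ (hW2 x hx)
    have hb := B.mem _ (hW2 y hy)
    have h2 : Φ.φ (γ x) (a - b) = γ y := by
      have := congrArg (fun p => Φ.φ p (-(T + b))) h1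
      simp only [Φ.φ_add _ (hW1 x hx).1, Φ.φ_add _ (hW1 y hy).1] at this
      rw [add_neg_cancel, Φ.φ_zero _ (hW1 y hy).1] at this
      rw [← this]; congr 1; ring
    have h3 := B.uniq (hW1 x hx) (t := a - b) ⟨by linarith [ha.1, hb.2], by linarith [ha.2, hb.1]⟩ (by rw [h2]; exact γg y)
    rw [B.s_line (hW1 x hx) (γg x)] at h3
    rw [h3, Φ.φ_zero _ (hW1 x hx).1] at h2
    exact γinj h2
  have i0 : (0:ℝ) ∈ Icc 0 δ := ⟨le_rfl, hδ.le⟩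
  have P0 : P 0 = 0 := by
    simp only [hP, hκ, γ0, hT, B.s_z hz, Φ.φ_zero z hz.1]
    simp [dt]
  have Pmono : StrictMonoOn P (Icc 0 δ) := by
    refine Pc.strictMonoOn_of_injOn_Icc hδ.le ?_ Pinj
    rw [P0]
    exact div_nonneg ((hsub ⟨hδ.le, le_rfl⟩).2 hδ) hvv.le
  have main : ∀ x0 ∈ Icc 0 δ, P x0 = x0 := by
    intro x0 hx0
    by_contra hne
    have hx0p : 0 < x0 := lt_of_le_of_ne hx0.1 (fun h => hne (by rw [← h, P0]))
    have hwA : γ x0 ∈ dA := by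
      refine ⟨(hW1 x0 hx0).1, fun h => ?_⟩
      have hη := B.hη
      have := B.pos _ (hW1 x0 hx0) 0 ⟨by linarith, by linarith⟩
      rw [Φ.φ_zero _ (hW1 x0 hx0).1, (Φ.F_zero_iff _ (hW1 x0 hx0).1).2 h] at this
      simp [dt] at this
    have hfin := finite_hits B hN hvN hW1 hwA
    have hfin2 : {x | x ∈ Icc 0 δ ∧ γ x ∈ range (Φ.φ (γ x0))}.Finite := by
      refine Set.Finite.of_finite_image (f := γ) (hfin.subset ?_) γinj.injOn
      rintro _ ⟨x, hx, rfl⟩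
      exact ⟨⟨x, hx.1, rfl⟩, hx.2⟩
    have hx0r : γ x0 ∈ range (Φ.φ (γ x0)) := ⟨0, Φ.φ_zero _ hwA.1⟩
    rcases lt_or_gt_of_ne hne with hlt | hgt
    · set S := {x | x ∈ Ioc 0 x0 ∧ γ x ∈ range (Φ.φ (γ x0)) ∧ P x < x}
      have hSf : S.Finite := hfin2.subset fun x hx => ⟨⟨hx.1.1.le, hx.1.2.trans hx0.2⟩, hx.2.1⟩
      obtain ⟨m, hm, hmin⟩ := Set.exists_min_image S id hSf ⟨x0, ⟨hx0p, le_rfl⟩, hx0r, hlt⟩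
      have hmI : m ∈ Icc 0 δ := ⟨hm.1.1.le, hm.1.2.trans hx0.2⟩
      have hPm : 0 < P m := by rw [← P0]; exact Pmono i0 hmI hm.1.1
      have hPmI : P m ∈ Icc 0 δ := ⟨hPm.le, hm.2.2.le.trans hmI.2⟩
      have : P m ∈ S := by
        refine ⟨⟨hPm, hm.2.2.le.trans hm.1.2⟩, ?_, Pmono hPmI hmI hm.2.2⟩
        obtain ⟨t, ht⟩ := hm.2.1
        rw [← κP m hmI, κφ m hmI, ← ht, Φ.φ_add _ hwA.1]
        exact ⟨_, rfl⟩
      exact absurd (hmin _ this) (not_le.2 hm.2.2)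
    · set S := {x | x ∈ Ioc 0 x0 ∧ γ x ∈ range (Φ.φ (γ x0)) ∧ x < P x}
      have hSf : S.Finite := hfin2.subset fun x hx => ⟨⟨hx.1.1.le, hx.1.2.trans hx0.2⟩, hx.2.1⟩
      obtain ⟨m, hm, hmin⟩ := Set.exists_min_image S id hSf ⟨x0, ⟨hx0p, le_rfl⟩, hx0r, hgt⟩
      have hmI : m ∈ Icc 0 δ := ⟨hm.1.1.le, hm.1.2.trans hx0.2⟩
      obtain ⟨y, hy, hym⟩ := intermediate_value_Icc hm.1.1.le (Pc.mono (Icc_subset_Icc_right hmI.2))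
        (show m ∈ Icc (P 0) (P m) from ⟨by rw [P0]; exact hm.1.1.le, hm.2.2.le⟩)
      have hyI : y ∈ Icc 0 δ := ⟨hy.1, hy.2.trans hmI.2⟩
      have hylt : y < m := lt_of_le_of_ne hy.2 (fun h => by
        have := hm.2.2; rw [h] at hym; linarith)
      have hyp : 0 < y := lt_of_le_of_ne hy.1 (fun h => by
        have := hm.1.1; rw [← h, P0] at hym; linarith)
      have : y ∈ S := by
        refine ⟨⟨hyp, hylt.le.trans hm.1.2⟩, ?_, by rw [hym]; exact hylt⟩
        obtain ⟨t, ht⟩ := hm.2.1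
        have h1 := κP y hyI
        rw [hym, κφ y hyI, ← ht] at h1
        have h2 := phi_neg Φ (hW1 y hyI).1 (T + B.s (Φ.φ (γ y) T))
        rw [h1, Φ.φ_add _ hwA.1] at h2
        exact ⟨_, h2⟩
      exact absurd (hmin _ this) (not_le.2 hylt)
  filter_upwards [Icc_mem_nhdsGE hδ] with x hx
  have := κP x hx
  rw [main x hx] at this
  exact this

end

section
open Filter Topology

theorem det_formula (L : Pt →L[ℝ] Pt) : LinearMap.det (L : Pt →ₗ[ℝ] Pt) =
    (L (1, 0)).1 * (L (0, 1)).2 - (L (0, 1)).1 * (L (1, 0)).2 := by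
  rw [← LinearMap.det_toMatrix (Module.Basis.finTwoProd ℝ), Matrix.det_fin_two]
  simp [LinearMap.toMatrix_apply]

theorem L_formula (L : Pt →L[ℝ] Pt) (a b : ℝ) : L (a, b) =
    (a * (L (1, 0)).1 + b * (L (0, 1)).1, a * (L (1, 0)).2 + b * (L (0, 1)).2) := by
  have : ((a, b) : Pt) = a • ((1, 0) : Pt) + b • ((0, 1) : Pt) := by simp
  conv_lhs => rw [this, map_add, map_smul, map_smul]
  ext <;> simp

theorem trans_pos {L : Pt →L[ℝ] Pt} {N v : Pt} (hN : N ≠ 0) (hv : v ≠ 0) (hvN : dt v N = 0) (hL : L N = N)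
    (hdet : 0 < LinearMap.det (L : Pt →ₗ[ℝ] Pt)) : 0 < dt (L v) v := by
  have hNN := dt_pos hN
  have hvv := dt_pos hv
  rw [det_formula] at hdet
  obtain ⟨n1, n2⟩ := N
  obtain ⟨v1, v2⟩ := v
  rw [L_formula] at hL ⊢
  set a := (L (1, 0)).1
  set c := (L (1, 0)).2
  set b := (L (0, 1)).1
  set d := (L (0, 1)).2
  have e1 := congrArg Prod.fst hL
  have e2 := congrArg Prod.snd hL
  simp only [dt] at *
  have hk1 : ((a - 1) * (d - 1) - b * c) * n1 = 0 := by linear_combination (d - 1) * e1 - b * e2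
  have hk2 : ((a - 1) * (d - 1) - b * c) * n2 = 0 := by linear_combination (a - 1) * e2 - c * e1
  have hk : (a - 1) * (d - 1) - b * c = 0 := by
    have : ((a - 1) * (d - 1) - b * c) * (n1 * n1 + n2 * n2) = 0 := by linear_combination n1 * hk1 + n2 * hk2
    rcases mul_eq_zero.1 this with h | h
    · exact h
    · linarith
  have key : ((v1 * a + v2 * b) * v1 + (v1 * c + v2 * d) * v2) * (n1 * n1 + n2 * n2) =
      (a * d - b * c) * (v1 * v1 + v2 * v2) * (n1 * n1 + n2 * n2) := by
    have h1 : v1 * v1 * (n1 * n1 + n2 * n2) = n2 * n2 * (v1 * v1 + v2 * v2) := by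
      linear_combination (v1 * n1 - v2 * n2) * hvN
    have h2 : v2 * v2 * (n1 * n1 + n2 * n2) = n1 * n1 * (v1 * v1 + v2 * v2) := by
      linear_combination (v2 * n2 - v1 * n1) * hvN
    have h3 : v1 * v2 * (n1 * n1 + n2 * n2) = - n1 * n2 * (v1 * v1 + v2 * v2) := by
      linear_combination (v1 * n2 + v2 * n1) * hvN
    linear_combination a * h1 + d * h2 + (b + c) * h3 + (v1 * v1 + v2 * v2) * (- n1 * e1 - n2 * e2) -
      (v1 * v1 + v2 * v2) * (n1 * n1 + n2 * n2) * hk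
  have : (v1 * a + v2 * b) * v1 + (v1 * c + v2 * d) * v2 = (a * d - b * c) * (v1 * v1 + v2 * v2) :=
    mul_right_cancel₀ hNN.ne' key
  rw [this]
  exact mul_pos hdet hvv

variable {Φ : TCFlow} {θ : Pt → ℝ}

theorem pos_int {z v : Pt} (hz : z ∈ dA) (hzo : z ∈ oD) (B : FB Φ z) {T : ℝ} (hT : Φ.φ z T = z) (hv : v ≠ 0)
    (hvN : dt v (Φ.F z) = 0) :
    ∀ᶠ x : ℝ in 𝓝[>] 0, 0 ≤ dt (Φ.φ (Φ.φ (z + x • v) T) (B.s (Φ.φ (z + x • v) T)) - z) v := by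
  have hN : Φ.F z ≠ 0 := fun h => hz.2 ((Φ.F_zero_iff z hz.1).1 h)
  set N := Φ.F z with hNd
  set Q := fun p : Pt × ℝ => Φ.φ p.1 p.2 with hQ
  set Q' := fderiv ℝ Q (z, 0) with hQ'
  have hQd : HasFDerivAt Q Q' (z, 0) := by
    apply DifferentiableAt.hasFDerivAt
    refine ((Φ.φ_smooth.differentiableOn (by simp)) (z, 0) ⟨hz.1, mem_univ _⟩).differentiableAt ?_
    exact prod_mem_nhds (disk_nhds hzo) univ_mem
  have q1 : ∀ a : Pt, Q' (a, 0) = a := by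
    intro a
    have h1 := phi_fd Φ hzo 0
    have h2 : HasFDerivAt (fun w => Φ.φ w 0) (ContinuousLinearMap.id ℝ Pt) z := by
      refine (hasFDerivAt_id z).congr_of_eventuallyEq ?_
      filter_upwards [disk_nhds hzo] with w hw using Φ.φ_zero w hw
    have := h1.unique h2
    exact congrArg (fun L : Pt →L[ℝ] Pt => L a) this
  have q2 : Q' (0, 1) = N := by
    have h1 : HasDerivAt (fun t : ℝ => Q (z, t)) (Q' (0, 1)) 0 :=
      HasFDerivAt.comp_hasDerivAt (f := fun t : ℝ => (z, t)) (0:ℝ) hQd ((hasDerivAt_const (0:ℝ) z).prodMk (hasDerivAt_id (0:ℝ)))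
    have h2 := Φ.φ_deriv z hz.1 0
    rw [Φ.φ_zero z hz.1] at h2
    exact h1.unique h2
  have q3 : ∀ (a : Pt) (t : ℝ), Q' (a, t) = a + t • N := fun a t => by
    have : ((a, t) : Pt × ℝ) = (a, 0) + t • ((0, 1) : Pt × ℝ) := by simp
    rw [this, map_add, map_smul, q1, q2]
  let dN : Pt →L[ℝ] ℝ := N.1 • ContinuousLinearMap.fst ℝ ℝ ℝ + N.2 • ContinuousLinearMap.snd ℝ ℝ ℝ
  let dv : Pt →L[ℝ] ℝ := v.1 • ContinuousLinearMap.fst ℝ ℝ ℝ + v.2 • ContinuousLinearMap.snd ℝ ℝ ℝ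
  have hdN : ∀ a, dN a = dt a N := fun a => by simp [dN, dt]; ring
  have hdv : ∀ a, dv a = dt a v := fun a => by simp [dv, dt]; ring
  have hGd : HasFDerivAt (fun p : Pt × ℝ => dN (Q p - z)) (dN.comp Q') (z, 0) :=
    dN.hasFDerivAt.comp _ (hQd.sub_const z)
  have hs0 := B.s_z hz
  have hDn : diskD ∈ 𝓝 z := disk_nhds hzo
  have hWn : diskD ∩ B.U ∈ 𝓝 z := inter_mem hDn (B.hU.mem_nhds B.hz)
  have hsd := ift_deriv (s := univ) (G := fun p : Pt × ℝ => dN (Q p - z)) (τ := B.s) (w := z) (L := dN.comp Q') (mem_univ _)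
    (by rw [hs0]; exact hGd.hasFDerivWithinAt) ((B.cont z ⟨hz.1, B.hz⟩).continuousAt hWn).continuousWithinAt
    (by
      rw [nhdsWithin_univ]
      filter_upwards [hWn] with w hw
      rw [hdN]; exact B.zero w hw)
    (by
      simp only [ContinuousLinearMap.comp_apply, q2, hdN]
      exact (dt_pos hN).ne')
  rw [hasFDerivWithinAt_univ] at hsd
  set s' := (-((dN.comp Q') (0, 1))⁻¹ • (dN.comp Q').comp (ContinuousLinearMap.inl ℝ Pt ℝ))
  have hρ : HasFDerivAt (fun w => dv (Φ.φ w (B.s w) - z)) (dv.comp (Q'.comp ((ContinuousLinearMap.id ℝ Pt).prod s'))) z := by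
    refine dv.hasFDerivAt.comp z (HasFDerivAt.sub_const z ?_)
    have hQd2 : HasFDerivAt Q Q' (z, B.s z) := by rw [hs0]; exact hQd
    exact HasFDerivAt.comp (f := fun w : Pt => (w, B.s w)) z hQd2 ((hasFDerivAt_id z).prodMk hsd)
  have hρ' : dv.comp (Q'.comp ((ContinuousLinearMap.id ℝ Pt).prod s')) = dv := by
    apply ContinuousLinearMap.ext
    intro a
    simp only [ContinuousLinearMap.comp_apply, ContinuousLinearMap.prod_apply, ContinuousLinearMap.id_apply, q3, map_add, map_smul]
    have : dv N = 0 := by rw [hdv]; simp only [dt] at hvN ⊢; linarith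
    rw [this]; simp
  rw [hρ'] at hρ
  set L := (fderiv ℝ (fun p : Pt × ℝ => Φ.φ p.1 p.2) (z, T)).comp (ContinuousLinearMap.inl ℝ Pt ℝ) with hL
  have hLd := phi_fd Φ hzo T
  rw [← hL] at hLd
  have hγ : HasDerivAt (fun x : ℝ => z + x • v) v 0 := by
    have := ((hasDerivAt_id (0:ℝ)).smul_const v).const_add z
    simpa using this
  have h1 : HasDerivAt (fun x : ℝ => Φ.φ (z + x • v) T) (L v) 0 := by
    refine HasFDerivAt.comp_hasDerivAt (l := fun w => Φ.φ w T) (0:ℝ) ?_ hγ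
    simpa using hLd
  have h2 : HasDerivAt (fun x : ℝ => dv (Φ.φ (Φ.φ (z + x • v) T) (B.s (Φ.φ (z + x • v) T)) - z)) (dv (L v)) 0 := by
    refine HasFDerivAt.comp_hasDerivAt (l := fun w => dv (Φ.φ w (B.s w) - z)) (0:ℝ) ?_ h1
    simpa [hT] using hρ
  have hpos : 0 < dv (L v) := by
    rw [hdv]
    refine trans_pos hN hv hvN ?_ (phi_det Φ hzo T)
    have := phi_fd_F Φ hz.1 hLd
    rwa [hT] at this
  have h3 := (hasDerivAt_iff_tendsto_slope.1 h2).eventually (lt_mem_nhds hpos)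
  have h4 : ∀ᶠ x : ℝ in 𝓝[>] 0, 0 < slope (fun x : ℝ => dv (Φ.φ (Φ.φ (z + x • v) T) (B.s (Φ.φ (z + x • v) T)) - z)) 0 x :=
    h3.filter_mono (nhdsWithin_mono _ (fun x hx => ne_of_gt hx))
  filter_upwards [h4, self_mem_nhdsWithin] with x hx hx0
  have hx0' : 0 < x := hx0
  rw [slope_def_field] at hx
  have hb : dv (Φ.φ (Φ.φ (z + (0:ℝ) • v) T) (B.s (Φ.φ (z + (0:ℝ) • v) T)) - z) = 0 := by
    simp [hT, hs0, Φ.φ_zero z hz.1]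
  rw [hb, sub_zero, sub_zero] at hx
  rw [← hdv]
  by_contra hneg
  push Not at hneg
  have := div_neg_of_neg_of_pos hneg hx0'
  linarith

end

section
open Filter Topology

variable {Φ : TCFlow} {θ : Pt → ℝ}

theorem bd_perp {z : Pt} (hz : z ∈ bdD) : dt (-z) (Φ.F z) = 0 := by
  have hzD := bd_disk hz
  have h := Φ.φ_deriv z hzD 0
  rw [Φ.φ_zero z hzD] at h
  have h1 : HasDerivAt (fun t => (Φ.φ z t).1) (Φ.F z).1 0 := ((ContinuousLinearMap.fst ℝ ℝ ℝ).hasFDerivAt.comp_hasDerivAt 0 h)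
  have h2 : HasDerivAt (fun t => (Φ.φ z t).2) (Φ.F z).2 0 := ((ContinuousLinearMap.snd ℝ ℝ ℝ).hasFDerivAt.comp_hasDerivAt 0 h)
  have h3 := (h1.mul h1).add (h2.mul h2)
  have h4 : HasDerivAt ((fun t => (Φ.φ z t).1) * (fun t => (Φ.φ z t).1) + (fun t => (Φ.φ z t).2) * (fun t => (Φ.φ z t).2)) 0 (0:ℝ) := by
    refine (hasDerivAt_const (0:ℝ) (1:ℝ)).congr_of_eventuallyEq (Eventually.of_forall fun t => ?_)
    have := phi_bd Φ hz t
    simp only [bdD, mem_ofPred_eq] at this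
    simp only [Pi.add_apply, Pi.mul_apply]
    nlinarith
  have h5 := h3.unique h4
  rw [Φ.φ_zero z hzD] at h5
  simp only [dt, Prod.fst_neg, Prod.snd_neg]
  linarith

theorem ret {z : Pt} (hz : z ∈ dA) (B : FB Φ z) {T : ℝ} (hT : Φ.φ z T = z) :
    ∃ v : Pt, v ≠ 0 ∧ dt v (Φ.F z) = 0 ∧ ∀ᶠ x : ℝ in 𝓝 0, z + x • v ∈ diskD →
      Φ.φ (Φ.φ (z + x • v) T) (B.s (Φ.φ (z + x • v) T)) = z + x • v := by
  have hN : Φ.F z ≠ 0 := fun h => hz.2 ((Φ.F_zero_iff z hz.1).1 h)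
  have hsplit : ∀ v : Pt, (∀ᶠ x : ℝ in 𝓝[≥] 0, z + x • v ∈ diskD →
      Φ.φ (Φ.φ (z + x • v) T) (B.s (Φ.φ (z + x • v) T)) = z + x • v) →
      (∀ᶠ x : ℝ in 𝓝[≤] 0, z + x • v ∈ diskD →
      Φ.φ (Φ.φ (z + x • v) T) (B.s (Φ.φ (z + x • v) T)) = z + x • v) →
      ∀ᶠ x : ℝ in 𝓝 0, z + x • v ∈ diskD →
      Φ.φ (Φ.φ (z + x • v) T) (B.s (Φ.φ (z + x • v) T)) = z + x • v := by
    intro v h1 h2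
    rw [← nhdsLE_sup_nhdsGE, eventually_sup]
    exact ⟨h2, h1⟩
  rcases disk_cases hz.1 with hzo | hzb
  · set v : Pt := (-(Φ.F z).2, (Φ.F z).1) with hv
    have hv0 : v ≠ 0 := by
      intro h
      apply hN
      rw [hv] at h
      have e1 := congrArg Prod.fst h
      have e2 := congrArg Prod.snd h
      simp at e1 e2
      exact Prod.ext e2 e1
    have hvN : dt v (Φ.F z) = 0 := by simp only [hv, dt]; ring
    have hDn : ∀ u : Pt, ∀ᶠ x : ℝ in 𝓝[≥] 0, z + x • u ∈ diskD := by
      intro u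
      have hc : Continuous (fun x : ℝ => z + x • u) := by fun_prop
      have := hc.tendsto 0
      simp only [zero_smul, add_zero] at this
      exact (this.eventually (disk_nhds hzo)).filter_mono nhdsWithin_le_nhds
    have hvN' : dt (-v) (Φ.F z) = 0 := by simp only [dt, Prod.fst_neg, Prod.snd_neg] at *; linarith
    refine ⟨v, hv0, hvN, hsplit v ?_ ?_⟩
    · exact (one_side hz B hT hv0 hvN (hDn v) (pos_int hz hzo B hT hv0 hvN)).mono fun x hx _ => hx
    · have h1 := one_side hz B hT (neg_ne_zero.2 hv0) hvN' (hDn (-v)) (pos_int hz hzo B hT (neg_ne_zero.2 hv0) hvN')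
      have h2 : Tendsto (fun x : ℝ => -x) (𝓝[≤] 0) (𝓝[≥] 0) := by
        have := tendsto_neg_nhdsLE (a := (0:ℝ))
        rwa [neg_zero] at this
      filter_upwards [h2.eventually h1] with x hx _
      simpa using hx
  · have hzb' := hzb
    simp only [bdD, mem_ofPred_eq] at hzb'
    have hv0 : -z ≠ 0 := by
      intro h
      rw [neg_eq_zero] at h
      exact hz.2 h
    have hvN : dt (-z) (Φ.F z) = 0 := bd_perp hzb
    have hD : ∀ᶠ x : ℝ in 𝓝[≥] 0, z + x • (-z) ∈ diskD := by
      have h1 : ∀ᶠ x : ℝ in 𝓝[≥] 0, x < 1 := (gt_mem_nhds one_pos).filter_mono nhdsWithin_le_nhds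
      filter_upwards [h1, self_mem_nhdsWithin] with x hx hx0
      have hx0 : 0 ≤ x := hx0
      simp only [diskD, mem_ofPred_eq, Prod.fst_add, Prod.snd_add, Prod.smul_fst, Prod.smul_snd, smul_eq_mul, Prod.fst_neg, Prod.snd_neg]
      have : (z.1 + x * -z.1) ^ 2 + (z.2 + x * -z.2) ^ 2 = (1 - x) ^ 2 := by linear_combination (1 - x)^2 * hzb'
      rw [this]; nlinarith
    have hγ : Tendsto (fun x : ℝ => z + x • (-z)) (𝓝[≥] 0) (𝓝[diskD] z) := by
      rw [tendsto_nhdsWithin_iff]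
      refine ⟨?_, hD⟩
      have hc : Continuous (fun x : ℝ => z + x • (-z)) := by fun_prop
      have := hc.tendsto 0
      simp only [zero_smul, add_zero] at this
      exact this.mono_left nhdsWithin_le_nhds
    have hγT : Tendsto (fun x : ℝ => Φ.φ (z + x • (-z)) T) (𝓝[≥] 0) (𝓝[diskD] z) := by
      have := phi_tendsto Φ hz.1 hγ (tendsto_const_nhds (x := T))
      rwa [hT] at this
    have hev : ∀ᶠ x : ℝ in 𝓝[≥] 0, Φ.φ (z + x • (-z)) T ∈ diskD ∩ B.U :=
      hγT.eventually (inter_mem_nhdsWithin _ (B.hU.mem_nhds B.hz))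
    have hpos : ∀ᶠ x : ℝ in 𝓝[>] 0, 0 ≤ dt (Φ.φ (Φ.φ (z + x • (-z)) T) (B.s (Φ.φ (z + x • (-z)) T)) - z) (-z) := by
      filter_upwards [hev.filter_mono (nhdsWithin_mono _ Ioi_subset_Ici_self)] with x hx
      have hm := Φ.φ_mapsTo _ hx.1 (B.s (Φ.φ (z + x • (-z)) T))
      set p := Φ.φ (Φ.φ (z + x • (-z)) T) (B.s (Φ.φ (z + x • (-z)) T))
      simp only [diskD, mem_ofPred_eq] at hm
      simp only [dt, Prod.fst_neg, Prod.snd_neg, Prod.fst_sub, Prod.snd_sub]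
      nlinarith [sq_nonneg (p.1 - z.1), sq_nonneg (p.2 - z.2)]
    refine ⟨-z, hv0, hvN, hsplit _ ?_ ?_⟩
    · exact (one_side hz B hT hv0 hvN hD hpos).mono fun x hx _ => hx
    · have h0 := (one_side hz B hT hv0 hvN hD hpos).self_of_nhdsWithin (x := (0:ℝ)) (by simp)
      filter_upwards [self_mem_nhdsWithin] with x hx hxD
      have hx : x ≤ 0 := hx
      simp only [diskD, mem_ofPred_eq, Prod.fst_add, Prod.snd_add, Prod.smul_fst, Prod.smul_snd, smul_eq_mul, Prod.fst_neg, Prod.snd_neg] at hxD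
      have : (z.1 + x * -z.1) ^ 2 + (z.2 + x * -z.2) ^ 2 = (1 - x) ^ 2 := by linear_combination (1 - x)^2 * hzb'
      rw [this] at hxD
      have : x = 0 := by nlinarith
      subst this
      exact h0

theorem theta_upper (hθ : IsMinPeriod Φ θ) {z : Pt} (hz : z ∈ dA) {ε : ℝ} (hε : 0 < ε) :
    ∀ᶠ w in 𝓝[dA] z, θ w ≤ θ z + ε := by
  obtain ⟨B⟩ := flowbox Φ hz
  obtain ⟨hTp, hT, -⟩ := hθ z hz
  obtain ⟨v, hv, hvN, hQ⟩ := ret hz B hT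
  have hN : Φ.F z ≠ 0 := fun h => hz.2 ((Φ.F_zero_iff z hz.1).1 h)
  have hle : 𝓝[dA] z ≤ 𝓝[diskD] z := nhdsWithin_mono _ sdiff_subset
  have hp : Tendsto (fun w => Φ.φ w (B.s w)) (𝓝[dA] z) (𝓝[diskD] z) := by
    have := phi_tendsto Φ hz.1 (tendsto_id'.2 hle) ((B.tendsto hz).mono_left hle)
    rwa [Φ.φ_zero z hz.1] at this
  have hx : Tendsto (fun w => dt (Φ.φ w (B.s w) - z) v / dt v v) (𝓝[dA] z) (𝓝 0) := by
    have h1 := (hp.mono_right nhdsWithin_le_nhds).sub_const z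
    rw [sub_self] at h1
    have h2 := ((dt_cont.tendsto (0, v)).comp (h1.prodMk_nhds (tendsto_const_nhds (x := v)))).div_const (dt v v)
    simpa [dt] using h2
  have hpT : Tendsto (fun w => Φ.φ (Φ.φ w (B.s w)) (θ z)) (𝓝[dA] z) (𝓝[diskD] z) := by
    have := phi_tendsto Φ hz.1 hp (tendsto_const_nhds (x := θ z))
    rwa [hT] at this
  have hs := (B.tendsto hz).comp hpT
  have e1 := hs.eventually (gt_mem_nhds hε)
  have e2 := hs.eventually (lt_mem_nhds (neg_lt_zero.2 hTp))
  have e3 : ∀ᶠ w in 𝓝[dA] z, w ∈ diskD ∩ B.U := hle (inter_mem_nhdsWithin _ (B.hU.mem_nhds B.hz))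
  filter_upwards [e1, e2, e3, hx.eventually hQ, self_mem_nhdsWithin] with w h1 h2 h3 h4 h5
  have hl := line hN hv hvN (B.zero w h3)
  rw [← hl] at h4
  have hpd := phi_dA Φ h5 (B.s w)
  have h6 := h4 hpd.1
  rw [Φ.φ_add _ hpd.1] at h6
  simp only [Function.comp] at h1 h2
  have := per_le hθ hpd (by linarith) h6
  rw [per_orb hθ h5] at this
  linarith

theorem theta_lower (hθ : IsMinPeriod Φ θ) {z : Pt} (hz : z ∈ dA) :
    ∃ η > 0, ∀ᶠ w in 𝓝[dA] z, η ≤ θ w := by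
  obtain ⟨B⟩ := flowbox Φ hz
  refine ⟨B.η, B.hη, ?_⟩
  have hle : 𝓝[dA] z ≤ 𝓝[diskD] z := nhdsWithin_mono _ sdiff_subset
  have e3 : ∀ᶠ w in 𝓝[dA] z, w ∈ diskD ∩ B.U := hle (inter_mem_nhdsWithin _ (B.hU.mem_nhds B.hz))
  filter_upwards [e3, self_mem_nhdsWithin] with w h3 h5
  obtain ⟨hTp, hT, -⟩ := hθ w h5
  by_contra hlt
  push Not at hlt
  have hη := B.hη
  have := B.mono w h3 (a := 0) (b := θ w) ⟨by linarith, by linarith⟩ ⟨by linarith, by linarith⟩ hTp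
  simp only [hT, Φ.φ_zero w h3.1] at this
  exact lt_irrefl _ this

theorem theta_cont (hθ : IsMinPeriod Φ θ) : ContinuousOn θ dA := by
  intro z hz
  have hle : 𝓝[dA] z ≤ 𝓝[diskD] z := nhdsWithin_mono _ sdiff_subset
  obtain ⟨η, hη, hlow⟩ := theta_lower hθ hz
  refine isCompact_Icc.tendsto_nhds_of_unique_mapClusterPt (s := Icc η (θ z + 1)) ?_ ?_
  · filter_upwards [hlow, theta_upper hθ hz one_pos] with w h1 h2 using ⟨h1, h2⟩
  · intro t ht hcl
    obtain ⟨𝒰, hleU, htend⟩ := mapClusterPt_iff_ultrafilter.1 hcl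
    have h1 : Tendsto id (𝒰 : Filter Pt) (𝓝[diskD] z) := hleU.trans hle
    have h2 := (phi_tendsto Φ hz.1 h1 htend).mono_right nhdsWithin_le_nhds
    have h3 : Tendsto id (𝒰 : Filter Pt) (𝓝 (Φ.φ z t)) := by
      refine h2.congr' ?_
      have : ∀ᶠ w in (𝒰 : Filter Pt), w ∈ dA := hleU self_mem_nhdsWithin
      filter_upwards [this] with w hw using (hθ w hw).2.1
    have h4 : Φ.φ z t = z := tendsto_nhds_unique h3 (h1.mono_right nhdsWithin_le_nhds)
    refine le_antisymm ?_ (per_le hθ hz (lt_of_lt_of_le hη ht.1) h4)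
    refine le_of_forall_pos_le_add fun ε hε => ?_
    exact le_of_tendsto htend (hleU (theta_upper hθ hz hε))

end

section
open Filter Topology

variable {Φ : TCFlow} {θ : Pt → ℝ}

theorem exists_c (hθ : IsMinPeriod Φ θ) {h : Pt → Pt} (hc : ContinuousOn h diskD)
    (ho : ∀ z ∈ dA, ∃ t, h z = Φ.φ z t) :
    ∃ c : Pt → ℂ, ContinuousOn c dA ∧ (∀ z, ‖c z‖ = 1) ∧
      ∀ z ∈ dA, ∀ t : ℝ, (h z = Φ.φ z t ↔ c z = Complex.exp ((2 * Real.pi * (t / θ z) : ℝ) * Complex.I)) := by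
  have hex : ∀ z, ∃ t : ℝ, z ∈ dA → h z = Φ.φ z t ∧ t ∈ Icc 0 (θ z) := by
    intro z
    by_cases hz : z ∈ dA
    · obtain ⟨t, ht⟩ := ho z hz
      have hp := (hθ z hz).1
      refine ⟨t + ((-⌊t / θ z⌋ : ℤ) : ℝ) * θ z, fun _ => ⟨by rw [per_zmul hθ hz, ht], ?_, ?_⟩⟩
      · have := mul_le_mul_of_nonneg_right (Int.floor_le (t / θ z)) hp.le
        rw [div_mul_cancel₀ _ hp.ne'] at this
        push_cast; linarith
      · have := mul_le_mul_of_nonneg_right (Int.lt_floor_add_one (t / θ z)).le hp.le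
        rw [div_mul_cancel₀ _ hp.ne'] at this
        push_cast; linarith
    · exact ⟨0, fun h => absurd h hz⟩
  choose τ hτ using hex
  set c : Pt → ℂ := fun z => Complex.exp ((2 * Real.pi * (τ z / θ z) : ℝ) * Complex.I) with hcd
  have key : ∀ z ∈ dA, ∀ t : ℝ, (h z = Φ.φ z t ↔ c z = Complex.exp ((2 * Real.pi * (t / θ z) : ℝ) * Complex.I)) := by
    intro z hz t
    have hp := (hθ z hz).1
    have hpi := Real.pi_pos
    rw [(hτ z hz).1]
    simp only [hcd, Complex.exp_eq_exp_iff_exists_int]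
    constructor
    · intro he
      obtain ⟨n, hn⟩ := per_iff hθ hz he
      refine ⟨n, ?_⟩
      have : τ z / θ z = t / θ z + n := by rw [hn]; field_simp
      rw [this]; push_cast; ring
    · rintro ⟨n, hn⟩
      have h1 := congrArg Complex.im hn
      have h2 : (2 * Real.pi * (τ z / θ z) : ℝ) = 2 * Real.pi * (t / θ z) + n * (2 * Real.pi) := by
        have e : ((2 * Real.pi * (t / θ z) : ℝ) : ℂ) * Complex.I + n * (2 * Real.pi * Complex.I) =
          ((2 * Real.pi * (t / θ z) + n * (2 * Real.pi) : ℝ) : ℂ) * Complex.I := by push_cast; ring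
        rw [e] at h1
        simpa only [Complex.re_ofReal_mul, Complex.im_ofReal_mul, Complex.I_im, mul_one] using h1
      have h3 : τ z = t + n * θ z := by
        have : τ z / θ z = t / θ z + n := by
          have h4 : (2 * Real.pi) * (τ z / θ z) = (2 * Real.pi) * (t / θ z + n) := by linarith
          exact mul_left_cancel₀ (by positivity) h4
        field_simp at this
        linarith
      rw [h3, per_zmul hθ hz]
  refine ⟨c, ?_, fun z => Complex.norm_exp_ofReal_mul_I _, key⟩
  intro z hz
  have hle : 𝓝[dA] z ≤ 𝓝[diskD] z := nhdsWithin_mono _ sdiff_subset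
  rw [ContinuousWithinAt, tendsto_iff_ultrafilter]
  intro 𝒰 hU
  have hθt : Tendsto θ (𝒰 : Filter Pt) (𝓝 (θ z)) := (theta_cont hθ z hz).tendsto.mono_left hU
  have hmem : ∀ᶠ w in (𝒰 : Filter Pt), w ∈ dA := hU self_mem_nhdsWithin
  have hK : ∀ᶠ w in (𝒰 : Filter Pt), τ w ∈ Icc 0 (θ z + 1) := by
    filter_upwards [hmem, hθt.eventually (gt_mem_nhds (lt_add_one (θ z)))] with w h1 h2
    exact ⟨(hτ w h1).2.1, (hτ w h1).2.2.trans h2.le⟩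
  obtain ⟨t, -, ht⟩ := isCompact_Icc.ultrafilter_le_nhds (𝒰.map τ) (le_principal_iff.2 hK)
  have htend : Tendsto τ (𝒰 : Filter Pt) (𝓝 t) := ht
  have h1 : Tendsto id (𝒰 : Filter Pt) (𝓝[diskD] z) := hU.trans hle
  have h2 := (phi_tendsto Φ hz.1 h1 htend).mono_right nhdsWithin_le_nhds
  have h3 : Tendsto h (𝒰 : Filter Pt) (𝓝 (Φ.φ z t)) := by
    refine h2.congr' ?_
    filter_upwards [hmem] with w hw using (hτ w hw).1.symm
  have h4 := tendsto_nhds_unique ((hc z hz.1).tendsto.comp h1) h3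
  rw [(key z hz t).1 h4]
  have hce : Continuous (fun x : ℝ => Complex.exp ((2 * Real.pi * x : ℝ) * Complex.I)) := by fun_prop
  exact (hce.tendsto (t / θ z)).comp (htend.div hθt (hθ z hz).1.ne')

def toC (p : Pt) : ℂ := ⟨p.1, p.2⟩
def toP (z : ℂ) : Pt := (z.re, z.im)
theorem toC_toP (z : ℂ) : toC (toP z) = z := rfl
theorem toP_toC (z : Pt) : toP (toC z) = z := rfl
theorem toC_cont : Continuous toC := Complex.equivRealProdCLM.symm.continuous
theorem toP_cont : Continuous toP := by unfold toP; fun_prop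

theorem norm_toC (p : Pt) : ‖toC p‖ ^ 2 = p.1 ^ 2 + p.2 ^ 2 := by
  rw [← Complex.normSq_eq_norm_sq, Complex.normSq_apply]; simp [toC]; ring

theorem toC_cA {p : Pt} : toC p ∈ cA ↔ p ∈ dA := by
  have h1 := norm_toC p
  have h2 : ‖toC p‖ ≤ 1 ↔ p ∈ diskD := by
    simp only [diskD, mem_ofPred_eq]; rw [← h1, sq_le_one_iff₀ (norm_nonneg _)]
  have h3 : toC p = 0 ↔ p = ptO := by
    constructor
    · intro h; have := congrArg toP h; rw [toP_toC] at this; exact this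
    · rintro rfl; rfl
  simp only [cA, dA, mem_ofPred_eq, Set.mem_sdiff, mem_singleton_iff, h2, h3, ne_eq]
  tauto

theorem toP_dA {z : ℂ} : toP z ∈ dA ↔ z ∈ cA := by rw [← toC_cA, toC_toP]

theorem toC_ne {p : Pt} (h : p ∈ dA) : toC p ≠ 0 := by
  have := toC_cA.2 h
  simp only [cA, mem_ofPred_eq] at this
  exact this.1

theorem log_dA {f : Pt → ℂ} (hf : ContinuousOn f dA) (h0 : ∀ z ∈ dA, f z ≠ 0) :
    ∃ (d : ℤ) (g : Pt → ℂ), ContinuousOn g dA ∧ ∀ z ∈ dA, f z = toC z ^ d * Complex.exp (g z) := by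
  obtain ⟨d, g, hg, hfg⟩ := log_A (f := f ∘ toP) (hf.comp toP_cont.continuousOn fun z hz => toP_dA.2 hz)
    (fun z hz => h0 _ (toP_dA.2 hz))
  refine ⟨d, g ∘ toC, hg.comp toC_cont.continuousOn fun z hz => toC_cA.2 hz, fun z hz => ?_⟩
  have := hfg _ (toC_cA.2 hz)
  simpa [toP_toC] using this

theorem dA_conn : IsPreconnected dA := by
  have hc : Continuous (fun w : ℝ × ℝ => toP (Complex.exp (((min w.1 0 : ℝ) : ℂ) + (w.2 : ℝ) * Complex.I))) := by
    refine toP_cont.comp ?_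
    fun_prop
  have := isPreconnected_univ.image _ hc.continuousOn
  convert this using 1
  ext p
  simp only [mem_image, mem_univ, true_and]
  constructor
  · intro hp
    have hn := toC_cA.2 hp
    simp only [cA, mem_ofPred_eq] at hn
    refine ⟨((Complex.log (toC p)).re, (Complex.log (toC p)).im), ?_⟩
    have : (Complex.log (toC p)).re ≤ 0 := by
      rw [Complex.log_re]; exact Real.log_nonpos (norm_nonneg _) hn.2
    rw [min_eq_left this]
    simp only
    rw [Complex.re_add_im, Complex.exp_log hn.1, toP_toC]
  · rintro ⟨w, rfl⟩
    rw [toP_dA]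
    simp only [cA, mem_ofPred_eq]
    refine ⟨Complex.exp_ne_zero _, ?_⟩
    rw [Complex.norm_exp]
    simp

end

section
open Filter Topology

variable {Φ : TCFlow} {θ : Pt → ℝ}

theorem near_O {h : Pt → Pt} {L : Pt →L[ℝ] Pt} (hd : HasFDerivAt h L ptO) (hO : h ptO = ptO)
    (hdet : 0 < LinearMap.det (L : Pt →ₗ[ℝ] Pt)) :
    ∃ (a : ℂ) (r : ℝ), a ≠ 0 ∧ 0 < r ∧ r ≤ 1 ∧ ∀ z : Pt, ‖toC z‖ = r →
      ‖toC (h z) - a * toC z‖ < ‖a * toC z‖ := by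
  rw [det_formula] at hdet
  set p := (L (1, 0)).1 with hp
  set q := (L (1, 0)).2 with hq
  set r := (L (0, 1)).1 with hr
  set s := (L (0, 1)).2 with hs
  set a : ℂ := ⟨(p + s) / 2, (q - r) / 2⟩ with ha
  set b : ℂ := ⟨(p - s) / 2, (q + r) / 2⟩ with hb
  have hab : ‖b‖ < ‖a‖ := by
    have : ‖b‖ ^ 2 < ‖a‖ ^ 2 := by
      rw [← Complex.normSq_eq_norm_sq, ← Complex.normSq_eq_norm_sq, Complex.normSq_apply, Complex.normSq_apply]
      simp only [ha, hb]
      nlinarith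
    exact lt_of_pow_lt_pow_left₀ 2 (norm_nonneg _) this
  have ha0 : a ≠ 0 := fun h0 => by rw [h0, norm_zero] at hab; exact absurd hab (not_lt.2 (norm_nonneg _))
  have hL : ∀ z : Pt, toC (L z) = a * toC z + b * (starRingEnd ℂ) (toC z) := by
    intro z
    rw [show z = (z.1, z.2) from rfl, L_formula]
    apply Complex.ext
    · simp [toC, ha, hb]; ring
    · simp [toC, ha, hb]; ring
  set ε := (‖a‖ - ‖b‖) / 4 with hε
  have hε0 : 0 < ε := by rw [hε]; linarith
  have h1 := hd.isLittleO.def hε0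
  have hn : ∀ w : Pt, ‖toC w‖ ≤ 2 * ‖w‖ := by
    intro w
    refine (Complex.norm_le_abs_re_add_abs_im _).trans ?_
    have e1 : |w.1| ≤ ‖w‖ := norm_fst_le w
    have e2 : |w.2| ≤ ‖w‖ := norm_snd_le w
    simp only [toC]; linarith
  have hn' : ∀ w : Pt, ‖w‖ ≤ ‖toC w‖ := by
    intro w
    rw [Prod.norm_def]
    exact max_le (Complex.abs_re_le_norm (toC w)) (Complex.abs_im_le_norm (toC w))
  obtain ⟨δ, hδ, hball⟩ := Metric.eventually_nhds_iff.1 h1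
  refine ⟨a, min 1 (δ / 2), ha0, lt_min one_pos (by positivity), min_le_left _ _, fun z hz => ?_⟩
  have hr0 : 0 < ‖toC z‖ := by rw [hz]; exact lt_min one_pos (by positivity)
  have hzd : dist z ptO < δ := by
    have e : dist z ptO = ‖z‖ := by rw [dist_eq_norm]; congr 1; exact sub_zero z
    rw [e]
    refine lt_of_le_of_lt (hn' z) ?_
    rw [hz]
    exact lt_of_le_of_lt (min_le_right _ _) (by linarith)
  have h2 := hball hzd
  have e0 : z - ptO = z := sub_zero z
  rw [hO, e0] at h2
  have e1 : h z - ptO - L z = h z - L z := by congr 1; exact sub_zero _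
  rw [e1] at h2
  have h3 : toC (h z - L z) = toC (h z) - toC (L z) := by apply Complex.ext <;> simp [toC]
  have h4 : toC (h z) - a * toC z = toC (h z - L z) + b * (starRingEnd ℂ) (toC z) := by
    rw [h3, hL]; ring
  rw [h4]
  refine lt_of_le_of_lt (norm_add_le _ _) ?_
  rw [norm_mul, norm_mul, Complex.norm_conj]
  have h5 := hn (h z - L z)
  have h6 := hn' z
  nlinarith

theorem deg_h {h : Pt → Pt} {L : Pt →L[ℝ] Pt} (hd : HasFDerivAt h L ptO) (hO : h ptO = ptO)
    (hdet : 0 < LinearMap.det (L : Pt →ₗ[ℝ] Pt)) {hcont : ContinuousOn h diskD} {d : ℤ} {g : Pt → ℂ}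
    (hg : ContinuousOn g dA)
    (hh : ∀ z ∈ dA, toC (h z) = toC z * (toC z ^ d * Complex.exp (g z))) : d = 0 := by
  obtain ⟨a, r, ha, hr, hr1, hb⟩ := near_O hd hO hdet
  set E : ℝ → ℂ := fun s => Complex.exp (Real.log r + s * Complex.I) with hE
  have En : ∀ s, ‖E s‖ = r := fun s => by
    simp only [hE, Complex.norm_exp]; simp [Real.exp_log hr]
  have Ec : Continuous E := by fun_prop
  have EA : ∀ s, toP (E s) ∈ dA := fun s => by
    rw [toP_dA]; simp only [cA, mem_ofPred_eq]
    exact ⟨Complex.exp_ne_zero _, by rw [En]; exact hr1⟩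
  set u : ℝ → ℂ := fun s => toC (h (toP (E s))) / (a * E s) with hu
  have huc : Continuous u := by
    refine Continuous.div ?_ (by fun_prop) (fun s => mul_ne_zero ha (Complex.exp_ne_zero _))
    refine toC_cont.comp ?_
    exact hcont.comp_continuous (toP_cont.comp Ec) fun s => (EA s).1
  have hus : ∀ s, u s ∈ Complex.slitPlane := by
    intro s
    have h0 : a * E s ≠ 0 := mul_ne_zero ha (Complex.exp_ne_zero _)
    have h1 := hb (toP (E s)) (by rw [toC_toP, En])
    rw [toC_toP] at h1
    have h2 : ‖u s - 1‖ < 1 := by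
      have : u s - 1 = (toC (h (toP (E s))) - a * E s) / (a * E s) := by rw [sub_div, div_self h0]
      rw [this, norm_div, div_lt_one (norm_pos_iff.2 h0)]
      exact h1
    have := Complex.mem_slitPlane_of_norm_lt_one h2
    rwa [add_sub_cancel] at this
  have hgc : Continuous (fun s => g (toP (E s))) := hg.comp_continuous (toP_cont.comp Ec) EA
  set k : ℝ → ℂ := fun s => -Complex.log a + d * (Real.log r + s * Complex.I) + g (toP (E s)) - Complex.log (u s) with hk
  have hkc : Continuous k := by
    refine Continuous.sub (Continuous.add (by fun_prop) hgc) ?_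
    exact huc.clog hus
  have hk1 : ∀ s ∈ (univ : Set ℝ), Complex.exp (k s) = 1 := by
    intro s _
    simp only [hk]
    rw [Complex.exp_sub, Complex.exp_add, Complex.exp_add, Complex.exp_neg, Complex.exp_log ha,
      Complex.exp_log (Complex.slitPlane_ne_zero (hus s)), Complex.exp_int_mul]
    have h1 := hh _ (EA s)
    rw [toC_toP] at h1
    have h2 : a * E s * u s = E s * (E s ^ d * Complex.exp (g (toP (E s)))) := by
      rw [← h1]; simp only [hu]
      rw [mul_div_cancel₀]
      exact mul_ne_zero ha (Complex.exp_ne_zero _)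
    have h3 : a * u s = E s ^ d * Complex.exp (g (toP (E s))) := by
      have hE0 : E s ≠ 0 := Complex.exp_ne_zero _
      apply mul_left_cancel₀ hE0
      linear_combination h2
    have hu0 := Complex.slitPlane_ne_zero (hus s)
    change a⁻¹ * E s ^ d * Complex.exp (g (toP (E s))) / u s = 1
    rw [mul_assoc, ← h3]
    field_simp
  obtain ⟨n, hn⟩ := exp_const isPreconnected_univ hkc.continuousOn hk1
  have e : k (2 * Real.pi) = k 0 := (hn _ (mem_univ _)).trans (hn _ (mem_univ _)).symm
  have hE2 : E (2 * Real.pi) = E 0 := by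
    simp only [hE]
    rw [Complex.exp_add, Complex.exp_add]
    congr 1
    push_cast
    rw [Complex.exp_two_pi_mul_I]; simp
  have hu2 : u (2 * Real.pi) = u 0 := by simp only [hu, hE2]
  simp only [hk, hu2, hE2] at e
  have e2 : (d : ℂ) * (2 * Real.pi * Complex.I) = 0 := by
    push_cast at e
    linear_combination e
  rcases mul_eq_zero.1 e2 with h | h
  · exact_mod_cast h
  · exact absurd h Complex.two_pi_I_ne_zero

theorem deg_c (hθ : IsMinPeriod Φ θ) {h : Pt → Pt} {c : Pt → ℂ} (hc1 : ∀ z, ‖c z‖ = 1)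
    (hc : ∀ z ∈ dA, ∀ t : ℝ, (h z = Φ.φ z t ↔ c z = Complex.exp ((2 * Real.pi * (t / θ z) : ℝ) * Complex.I)))
    {d : ℤ} {g1 g2 : Pt → ℂ} (hg1 : ContinuousOn g1 dA) (hg2 : ContinuousOn g2 dA)
    (h1 : ∀ z ∈ dA, c z = toC z ^ d * Complex.exp (g1 z))
    (h2 : ∀ z ∈ dA, toC (h z) = toC z * Complex.exp (g2 z)) : d = 0 := by
  set z0 : Pt := (1, 0) with hz0
  have zb : z0 ∈ bdD := by simp [bdD, hz0]
  have zD : z0 ∈ dA := ⟨bd_disk zb, by simp [hz0, ptO]⟩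
  set T := θ z0 with hT
  obtain ⟨hTp, hTz, hTmin⟩ := hθ z0 zD
  rw [← hT] at hTp hTz hTmin
  set ψ := Φ.φ z0 with hψ
  have ψc : Continuous ψ := continuous_iff_continuousAt.2 fun t => (Φ.φ_deriv z0 zD.1 t).continuousAt
  have ψA : ∀ t, ψ t ∈ dA := phi_dA Φ zD
  have ψT : ∀ t, ψ (t + T) = ψ t := fun t => by
    have := per_zmul hθ zD 1 t
    rw [Int.cast_one, one_mul] at this; exact this
  obtain ⟨A, Ac, hA⟩ := exists_log (toC_cont.comp ψc) (fun t => toC_ne (ψA t))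
  simp only [Function.comp] at hA
  have hAre : ∀ t, (A t).re = 0 := by
    intro t
    have e := norm_toC (ψ t)
    have e2 := phi_bd Φ zb t
    simp only [bdD, mem_ofPred_eq] at e2
    rw [e2, ← hA, Complex.norm_exp] at e
    have e3 : Real.exp (A t).re = 1 := by nlinarith [Real.exp_pos (A t).re]
    exact Real.exp_eq_one_iff _ |>.1 e3
  have hAim : ∀ t, A t = (A t).im * Complex.I := fun t => by
    apply Complex.ext <;> simp [hAre]
  obtain ⟨m, hm⟩ := exp_const (f := fun t => A (t + T) - A t) isPreconnected_univ
    (by fun_prop) (fun t _ => by rw [Complex.exp_sub, hA, hA, ψT, div_self (toC_ne (ψA t))])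
  have hm1 : ∀ t, A (t + T) = A t + m * (2 * Real.pi * Complex.I) := fun t => by
    have := hm t (mem_univ _); linear_combination this
  have hmk : ∀ (k : ℤ) t, A (t + k * T) = A t + k * (m * (2 * Real.pi * Complex.I)) := by
    intro k
    induction k using Int.induction_on with
    | zero => intro t; simp
    | succ i ih =>
      intro t
      have := hm1 (t + i * T)
      have e : t + ((i + 1 : ℤ) : ℝ) * T = t + i * T + T := by push_cast; ring
      rw [e, this]
      have := ih t
      push_cast at this ⊢
      rw [this]; ring
    | pred i ih =>
      intro t
      have := hm1 (t + ((-i - 1 : ℤ) : ℝ) * T)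
      have e : t + ((-i - 1 : ℤ) : ℝ) * T + T = t + ((-i : ℤ) : ℝ) * T := by push_cast; ring
      rw [e, ih t] at this
      push_cast at this ⊢
      linear_combination -this
  have inj : ∀ s t, (A s).im = (A t).im → ∃ n : ℤ, s = t + n * T := by
    intro s t e
    have : ψ s = ψ t := by
      have e2 : toC (ψ s) = toC (ψ t) := by rw [← hA, ← hA, hAim s, hAim t, e]
      have := congrArg toP e2
      rwa [toP_toC, toP_toC] at this
    exact per_iff hθ zD this
  have hm0 : m ≠ 0 := by
    intro h0
    have aT : (A T).im = (A 0).im := by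
      have := hm1 0
      rw [h0, zero_add] at this
      rw [this]; simp
    have ac : Continuous (fun t => (A t).im) := Complex.continuous_im.comp Ac
    have hne : (A 0).im ≠ (A (T/2)).im := by
      intro e
      obtain ⟨n, hn⟩ := inj _ _ e
      have e1 : (n : ℝ) = -1/2 := by
        have : (n + 1/2 : ℝ) * T = 0 := by linarith
        rcases mul_eq_zero.1 this with h | h <;> linarith
      have e2 : ((2 * n : ℤ) : ℝ) = ((-1 : ℤ) : ℝ) := by push_cast; linarith
      have e3 : 2 * n = -1 := by exact_mod_cast e2
      omega
    set y := ((A 0).im + (A (T/2)).im) / 2 with hy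
    have hy1 : y ∈ uIcc (A 0).im (A (T/2)).im := by
      rw [mem_uIcc, hy]
      rcases le_total (A 0).im (A (T/2)).im with h | h
      · left; constructor <;> linarith
      · right; constructor <;> linarith
    have hy2 : y ∈ uIcc (A (T/2)).im (A T).im := by rw [aT, uIcc_comm]; exact hy1
    obtain ⟨t1, ht1, e1⟩ := intermediate_value_uIcc (f := fun t => (A t).im) ac.continuousOn hy1
    obtain ⟨t2, ht2, e2⟩ := intermediate_value_uIcc (f := fun t => (A t).im) ac.continuousOn hy2
    rw [uIcc_of_le (by linarith)] at ht1 ht2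
    simp only at e1 e2
    have hy0 : y ≠ (A 0).im := fun h => hne (by rw [hy] at h; linarith)
    have hyh : y ≠ (A (T/2)).im := fun h => hne (by rw [hy] at h; linarith)
    obtain ⟨n, hn⟩ := inj t2 t1 (e2.trans e1.symm)
    have l1 : t1 ≠ 0 := fun h => hy0 (by rw [← e1, h])
    have l2 : t1 ≠ T/2 := fun h => hyh (by rw [← e1, h])
    have l1' := lt_of_le_of_ne ht1.1 l1.symm
    have l2' := lt_of_le_of_ne ht1.2 l2
    have b1 : 0 < (n : ℝ) := by
      have : 0 < (n : ℝ) * T := by linarith [ht2.1]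
      exact pos_of_mul_pos_left this hTp.le
    have b2 : (n : ℝ) < 1 := by
      have : (n : ℝ) * T < 1 * T := by linarith [ht2.2]
      exact lt_of_mul_lt_mul_right this hTp.le
    have b1' : 0 < n := by exact_mod_cast b1
    have b2' : n < 1 := by exact_mod_cast b2
    omega
  set β : ℝ → ℝ := fun t => T / (2 * Real.pi) * (d * (A t).im + (g1 (ψ t)).im) with hβ
  have βc : Continuous β := by
    have : Continuous (fun t => g1 (ψ t)) := hg1.comp_continuous ψc ψA
    exact continuous_const.mul ((continuous_const.mul (Complex.continuous_im.comp Ac)).add (Complex.continuous_im.comp this))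
  have hpi := Real.pi_pos
  have hhψ : ∀ t, h (ψ t) = ψ (t + β t) := by
    intro t
    have e1 : h (ψ t) = Φ.φ (ψ t) (β t) := by
      rw [hc _ (ψA t), h1 _ (ψA t)]
      have eθ : θ (ψ t) = T := per_orb hθ zD t
      have e3 : toC (ψ t) ^ d * Complex.exp (g1 (ψ t)) = Complex.exp (d * A t + g1 (ψ t)) := by
        rw [Complex.exp_add, Complex.exp_int_mul, hA]
      have e4 : (d * A t + g1 (ψ t)).re = 0 := by
        have := hc1 (ψ t)
        rw [h1 _ (ψA t), e3, Complex.norm_exp] at this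
        exact Real.exp_eq_one_iff _ |>.1 this
      rw [e3, eθ]
      congr 1
      have e5 : 2 * Real.pi * (β t / T) = (d * A t + g1 (ψ t)).im := by
        simp only [hβ]
        have : (d * A t + g1 (ψ t)).im = d * (A t).im + (g1 (ψ t)).im := by simp
        rw [this]
        field_simp
      rw [e5]
      apply Complex.ext
      · rw [e4]; simp
      · simp
    rw [e1, hψ, Φ.φ_add z0 zD.1]
  obtain ⟨n, hn⟩ := exp_const (f := fun t => A (t + β t) - A t - g2 (ψ t)) isPreconnected_univ
    (by
      have : Continuous (fun t => g2 (ψ t)) := hg2.comp_continuous ψc ψA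
      exact (((Ac.comp (continuous_id.add βc)).sub Ac).sub this).continuousOn)
    (fun t _ => by
      rw [Complex.exp_sub, Complex.exp_sub, hA, hA, ← hhψ, h2 _ (ψA t)]
      have := toC_ne (ψA t)
      have := Complex.exp_ne_zero (g2 (ψ t))
      field_simp)
  have e := (hn T (mem_univ _)).trans (hn 0 (mem_univ _)).symm
  have ψT0 : ψ T = ψ 0 := by have := ψT 0; rwa [zero_add] at this
  have AT : A T = A 0 + m * (2 * Real.pi * Complex.I) := by have := hm1 0; rwa [zero_add] at this
  have βT : β T = β 0 + ((d * m : ℤ) : ℝ) * T := by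
    simp only [hβ]
    rw [ψT0, AT]
    have : (A 0 + m * (2 * Real.pi * Complex.I)).im = (A 0).im + m * (2 * Real.pi) := by simp
    rw [this]
    push_cast
    field_simp
    ring
  have e2 : T + β T = (0 + β 0) + ((1 + d * m : ℤ) : ℝ) * T := by rw [βT]; push_cast; ring
  rw [e2, hmk, AT, ψT0] at e
  have e3 : ((d * m * m : ℤ) : ℂ) * (2 * Real.pi * Complex.I) = 0 := by
    push_cast at e ⊢
    linear_combination e
  rcases mul_eq_zero.1 e3 with h | h
  · have : d * m * m = 0 := by exact_mod_cast h
    simpa [hm0] using this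
  · exact absurd h Complex.two_pi_I_ne_zero

end

/-- every `h ∈ E⁺(F)` admits a `C^∞` shift function `α` on `D² ∖ {O}`, and
any other `C^∞` shift function on `D² ∖ {O}` differs from `α` by an integer multiple of
the minimal period function `θ`. -/
theorem exists_shift_function_on_punctured_disk
    (Φ : TCFlow) (θ : Pt → ℝ) (hθ : IsMinPeriod Φ θ)
    (h : Pt → Pt) (hh : EplMem Φ h) :
    ∃ α : Pt → ℝ, ContDiffOn ℝ (⊤ : ℕ∞) α (diskD \ {ptO}) ∧
      (∀ z ∈ diskD \ {ptO}, h z = Φ.φ z (α z)) ∧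
      ∀ β : Pt → ℝ, ContDiffOn ℝ (⊤ : ℕ∞) β (diskD \ {ptO}) →
        (∀ z ∈ diskD \ {ptO}, h z = Φ.φ z (β z)) →
        ∃ n : ℤ, ∀ z ∈ diskD \ {ptO}, β z = α z + n * θ z := by
  obtain ⟨⟨hmaps, hsm, horb, -⟩, hdet⟩ := hh
  have hcont := hsm.continuousOn
  have ho : ∀ z ∈ diskD, ∃ t, h z = Φ.φ z t := by
    intro z hz
    have : h z ∈ h '' orb Φ z := mem_image_of_mem _ ⟨0, Φ.φ_zero z hz⟩
    rw [horb z hz] at this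
    obtain ⟨t, ht⟩ := this
    exact ⟨t, ht.symm⟩
  have hO : h ptO = ptO := by
    obtain ⟨t, ht⟩ := ho ptO O_disk
    rw [ht, phi_O]
  have hA : ∀ z ∈ dA, h z ∈ dA := by
    intro z hz
    obtain ⟨t, ht⟩ := ho z hz.1
    rw [ht]; exact phi_dA Φ hz t
  have hcA : ContinuousOn h dA := hcont.mono sdiff_subset
  have hL : HasFDerivAt h (fderiv ℝ h ptO) ptO := by
    apply DifferentiableAt.hasFDerivAt
    exact ((hsm.differentiableOn (by simp)) ptO O_disk).differentiableAt (disk_nhds O_oD)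
  obtain ⟨c, hcc, hc1, hc⟩ := exists_c hθ hcont (fun z hz => ho z hz.1)
  obtain ⟨d1, g1, hg1, e1⟩ := log_dA hcc (fun z _ h0 => by have := hc1 z; rw [h0, norm_zero] at this; exact zero_ne_one this)
  obtain ⟨d2, g2, hg2, e2⟩ := log_dA (f := fun z => toC (h z) / toC z)
    (ContinuousOn.div (toC_cont.comp_continuousOn hcA) toC_cont.continuousOn (fun z hz => toC_ne hz))
    (fun z hz => div_ne_zero (toC_ne (hA z hz)) (toC_ne hz))
  have e2' : ∀ z ∈ dA, toC (h z) = toC z * (toC z ^ d2 * Complex.exp (g2 z)) := fun z hz => by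
    rw [← e2 z hz, mul_div_cancel₀ _ (toC_ne hz)]
  have hd2 : d2 = 0 := deg_h hL hO hdet (hcont := hcont) hg2 e2'
  subst hd2
  have hd1 : d1 = 0 := deg_c hθ hc1 hc hg1 hg2 e1 (fun z hz => by rw [e2' z hz]; simp)
  subst hd1
  set α : Pt → ℝ := fun z => θ z * (g1 z).im / (2 * Real.pi) with hα
  have hpi := Real.pi_pos
  have αc : ContinuousOn α dA :=
    ((theta_cont hθ).mul (Complex.continuous_im.comp_continuousOn hg1)).div_const _
  have hhα : ∀ z ∈ dA, h z = Φ.φ z (α z) := by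
    intro z hz
    have hp := (hθ z hz).1
    rw [hc z hz, e1 z hz, zpow_zero, one_mul]
    have e4 : (g1 z).re = 0 := by
      have := hc1 z
      rw [e1 z hz, zpow_zero, one_mul, Complex.norm_exp] at this
      exact Real.exp_eq_one_iff _ |>.1 this
    have e5 : 2 * Real.pi * (α z / θ z) = (g1 z).im := by
      simp only [hα]; field_simp
    rw [e5]
    congr 1
    apply Complex.ext
    · rw [e4]; simp
    · simp
  refine ⟨α, ?_, hhα, ?_⟩
  · have hFh : ContDiffOn ℝ (⊤ : ℕ∞) (fun w => Φ.F (h w)) dA :=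
      (Φ.F_smooth.comp hsm hmaps).mono sdiff_subset
    have hq : ContDiffOn ℝ (⊤ : ℕ∞) (fun p : Pt × ℝ => Φ.φ p.1 p.2) (dA ×ˢ univ) :=
      Φ.φ_smooth.mono (prod_mono sdiff_subset subset_rfl)
    have hfst : ContDiffOn ℝ (⊤ : ℕ∞) (fun p : Pt × ℝ => p.1) (dA ×ˢ univ) := contDiff_fst.contDiffOn
    have hm : MapsTo (fun p : Pt × ℝ => p.1) (dA ×ˢ univ) dA := fun p hp => hp.1
    have hh1 : ContDiffOn ℝ (⊤ : ℕ∞) (fun p : Pt × ℝ => h p.1) (dA ×ˢ univ) :=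
      (hsm.mono sdiff_subset).comp hfst hm
    have hF1 : ContDiffOn ℝ (⊤ : ℕ∞) (fun p : Pt × ℝ => Φ.F (h p.1)) (dA ×ˢ univ) := hFh.comp hfst hm
    have hG : ContDiffOn ℝ (⊤ : ℕ∞) (fun p : Pt × ℝ => dt (Φ.φ p.1 p.2 - h p.1) (Φ.F (h p.1))) (dA ×ˢ univ) := by
      unfold dt
      have h3 := hq.sub hh1
      exact (h3.fst.mul hF1.fst).add (h3.snd.mul hF1.snd)
    refine ift_smooth dA_ud hG αc ?_ ?_
    · intro z hz
      simp only
      rw [← hhα z hz]; simp [dt]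
    · intro z hz
      have hd := (hG.differentiableOn (by simp)) (z, α z) ⟨hz, mem_univ _⟩
      have hd2 := hd.hasFDerivWithinAt
      have h3 : HasDerivAt (fun t : ℝ => ((z, t) : Pt × ℝ)) ((0, 1) : Pt × ℝ) (α z) :=
        (hasDerivAt_const (α z) z).prodMk (hasDerivAt_id (α z))
      have h4 := hd2.comp_hasDerivWithinAt (s := univ) (α z) h3.hasDerivWithinAt (fun t _ => ⟨hz, mem_univ _⟩)
      rw [hasDerivWithinAt_univ] at h4
      have h5 := g_deriv Φ (z := h z) (N := Φ.F (h z)) hz.1 (α z)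
      have h6 := h4.unique h5
      rw [h6, ← hhα z hz]
      exact (dt_pos (fun h0 => (hA z hz).2 ((Φ.F_zero_iff _ (hA z hz).1).1 h0))).ne'
  · intro β hβ hhβ
    have hn := int_const (f := fun z => (β z - α z) / θ z) dA_conn
      ((hβ.continuousOn.sub αc).div (theta_cont hθ) (fun z hz => (hθ z hz).1.ne'))
      (fun z hz => by
        obtain ⟨n, hn⟩ := per_iff hθ hz ((hhβ z hz).symm.trans (hhα z hz))
        have hp := (hθ z hz).1
        exact ⟨n, by rw [hn]; field_simp; ring⟩)
    obtain ⟨n, hn⟩ := hn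
    refine ⟨n, fun z hz => ?_⟩
    have := hn z hz
    rw [div_eq_iff (hθ z hz).1.ne'] at this
    linarith

end
end

section
/- Let (F, φ) be a TC flow on D² whose minimal period function θ satisfies θ(z) → +∞ as z → O (for every C > 0 there is a neighborhood U of O in D² such that θ(z) > C for all z ∈ U ∖ {O}). Let h ∈ E⁺(F) and suppose α, β : D² → ℝ are C^∞ functions on D² with h(z) = φ(z, α(z)) and h(z) = φ(z, β(z)) for all z ∈ D². Then α = β. In other words, each h ∈ E⁺(F) has at most one C^∞ shift function defined on all of D². -/
open Set

noncomputable section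

lemma aux_neg (Φ : TCFlow) (z : Pt) (hz : z ∈ diskD) (t : ℝ) (ht : Φ.φ z t = z) :
    Φ.φ z (-t) = z := by
  have h1 := Φ.φ_add z hz t (-t)
  rw [ht, add_neg_cancel, Φ.φ_zero z hz] at h1
  exact h1

lemma aux_comp (f f' : ℝ → ℝ) (t : ℝ) (ht : t ≠ 0) (e : ℝ) (hte : |t| < e)
    (hd : ∀ s, HasDerivAt f (f' s) s) (hf : f t = f 0) (hne : ∀ s, |s| < e → f' s ≠ 0) : False := by
  have hc : Continuous f := continuous_iff_continuousAt.2 fun s => (hd s).continuousAt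
  have hab := abs_lt.1 hte
  rcases lt_or_gt_of_ne ht with h | h
  · obtain ⟨c, hc1, hc2⟩ := exists_hasDerivAt_eq_zero h hc.continuousOn hf (fun x _ => hd x)
    exact hne c (abs_lt.2 ⟨by linarith [hc1.1], by linarith [hc1.2]⟩) hc2
  · obtain ⟨c, hc1, hc2⟩ := exists_hasDerivAt_eq_zero h hc.continuousOn hf.symm (fun x _ => hd x)
    exact hne c (abs_lt.2 ⟨by linarith [hc1.1], by linarith [hc1.2]⟩) hc2

lemma aux_ev (Φ : TCFlow) (L : Pt →L[ℝ] ℝ) (z₀ : Pt) (hz₀ : z₀ ∈ diskD) (hL : L (Φ.F z₀) ≠ 0) :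
    ∃ e > 0, ∀ z ∈ diskD, dist z z₀ < e → ∀ t : ℝ, |t| < e → Φ.φ z t = z → t = 0 := by
  have hF : ContinuousOn (fun p : Pt × ℝ => L (Φ.F (Φ.φ p.1 p.2))) (diskD ×ˢ (univ : Set ℝ)) := by
    refine L.continuous.comp_continuousOn ?_
    exact Φ.F_smooth.continuousOn.comp Φ.φ_smooth.continuousOn
      (fun p hp => Φ.φ_mapsTo p.1 hp.1 p.2)
  have h0 := hF (z₀, 0) ⟨hz₀, mem_univ _⟩
  have h1 := h0.eventually_ne (b₂ := 0) (by simpa [Φ.φ_zero z₀ hz₀] using hL)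
  rw [eventually_nhdsWithin_iff, Metric.eventually_nhds_iff] at h1
  obtain ⟨e, he, h1⟩ := h1
  refine ⟨e, he, fun z hz hd t ht hp => ?_⟩
  by_contra hne
  refine aux_comp (fun s => L (Φ.φ z s)) (fun s => L (Φ.F (Φ.φ z s))) t hne e ht ?_ ?_ ?_
  · intro s
    exact L.hasFDerivAt.comp_hasDerivAt s (Φ.φ_deriv z hz s)
  · simp [hp, Φ.φ_zero z hz]
  · intro s hs
    refine h1 (y := (z, s)) ?_ ⟨hz, mem_univ _⟩
    rw [Prod.dist_eq]
    exact max_lt hd (by simpa using hs)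

lemma aux_loc (Φ : TCFlow) (z₀ : Pt) (hz₀ : z₀ ∈ diskD) (hne : z₀ ≠ ptO) :
    ∃ e > 0, ∀ z ∈ diskD, dist z z₀ < e → ∀ t : ℝ, |t| < e → Φ.φ z t = z → t = 0 := by
  have hF : Φ.F z₀ ≠ 0 := fun h => hne ((Φ.F_zero_iff z₀ hz₀).1 h)
  by_cases h1 : (Φ.F z₀).1 = 0
  · refine aux_ev Φ (ContinuousLinearMap.snd ℝ ℝ ℝ) z₀ hz₀ fun h2 => hF (Prod.ext h1 h2)
  · exact aux_ev Φ (ContinuousLinearMap.fst ℝ ℝ ℝ) z₀ hz₀ h1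

/-- if the minimal period function `θ` of the TC flow tends to `+∞` at `O`,
then every `h ∈ E⁺(F)` has at most one `C^∞` shift function defined on all of `D²`. -/
theorem shift_function_unique_on_disk
    (Φ : TCFlow) (θ : Pt → ℝ) (hθ : IsMinPeriod Φ θ)
    (hdiv : ∀ C : ℝ, 0 < C → ∃ U : Set Pt, IsOpen U ∧ ptO ∈ U ∧
      ∀ z ∈ U ∩ diskD, z ≠ ptO → C < θ z)
    (h : Pt → Pt) (hh : EplMem Φ h)
    (α β : Pt → ℝ)
    (hα : ContDiffOn ℝ (⊤ : ℕ∞) α diskD) (hβ : ContDiffOn ℝ (⊤ : ℕ∞) β diskD)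
    (hαs : ∀ z ∈ diskD, h z = Φ.φ z (α z))
    (hβs : ∀ z ∈ diskD, h z = Φ.φ z (β z)) :
    ∀ z ∈ diskD, α z = β z := by
  have hOD : ptO ∈ diskD := by simp [ptO, diskD]
  let δ : Pt → ℝ := fun z => α z - β z
  have hδc : ContinuousOn δ diskD := hα.continuousOn.sub hβ.continuousOn
  have hδ : ∀ z ∈ diskD, Φ.φ z (δ z) = z := by
    intro z hz
    have e : Φ.φ z (α z) = Φ.φ z (β z) := (hαs z hz).symm.trans (hβs z hz)
    have h1 := Φ.φ_add z hz (α z) (-β z)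
    rw [e, Φ.φ_add z hz, add_neg_cancel, Φ.φ_zero z hz] at h1
    exact h1.symm
  -- near the origin
  have hO1 : ∀ᶠ z in nhdsWithin ptO diskD, z ≠ ptO → δ z = 0 := by
    obtain ⟨U, hU, hOU, hUθ⟩ := hdiv (|δ ptO| + 1) (by positivity)
    have h1 : ∀ᶠ z in nhdsWithin ptO diskD, |δ z| < |δ ptO| + 1 :=
      ((hδc ptO hOD).abs).eventually_lt_const (lt_add_one _)
    filter_upwards [h1, self_mem_nhdsWithin, mem_nhdsWithin_of_mem_nhds (hU.mem_nhds hOU)]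
      with z hz1 hzD hzU hne
    by_contra h0
    have h2 := (hθ z ⟨hzD, hne⟩).2.2 |δ z| (abs_pos.2 h0) (hz1.trans (hUθ z ⟨hzU, hzD⟩ hne))
    apply h2
    rcases abs_choice (δ z) with h | h <;> rw [h]
    · exact hδ z hzD
    · exact aux_neg Φ z hzD _ (hδ z hzD)
  have hO0 : δ ptO = 0 := by
    by_contra h0
    have h1 : ∀ᶠ z in nhdsWithin ptO diskD, z = ptO := by
      filter_upwards [hO1, (hδc ptO hOD).eventually_ne h0] with z h1 h2
      by_contra h3
      exact h2 (h1 h3)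
    rw [eventually_nhdsWithin_iff, Metric.eventually_nhds_iff] at h1
    obtain ⟨e, he, h1⟩ := h1
    have hm : 0 < min (e / 2) 1 := by positivity
    have hm1 : min (e / 2) 1 ≤ 1 := min_le_right _ _
    have hme : min (e / 2) 1 ≤ e / 2 := min_le_left _ _
    generalize min (e / 2) 1 = m at hm hm1 hme
    have h2 := h1 (y := (m, 0)) (by
      rw [ptO, Prod.dist_eq]
      simp only [dist_self, Real.dist_eq, sub_zero, abs_of_pos hm]
      exact max_lt (by linarith) he) (by
      simp only [diskD, mem_ofPred_eq]; nlinarith)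
    have h3 : m = 0 := congrArg Prod.fst h2
    exact hm.ne' h3
  have hloc : ∀ z₀ ∈ diskD, δ z₀ = 0 → ∀ᶠ z in nhdsWithin z₀ diskD, δ z = 0 := by
    intro z₀ hz₀ h0
    by_cases hne : z₀ = ptO
    · subst hne
      filter_upwards [hO1] with z hz
      by_cases h : z = ptO
      · rw [h, hO0]
      · exact hz h
    · obtain ⟨e, he, H⟩ := aux_loc Φ z₀ hz₀ hne
      have h1 : ∀ᶠ z in nhdsWithin z₀ diskD, |δ z| < e :=
        ((hδc z₀ hz₀).abs).eventually_lt_const (by simpa only [h0, abs_zero] using he)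
      filter_upwards [h1, self_mem_nhdsWithin,
        mem_nhdsWithin_of_mem_nhds (Metric.ball_mem_nhds z₀ he)] with z hz1 hzD hzb
      exact H z hzD hzb _ hz1 (hδ z hzD)
  intro z hz
  have hseg : ∀ s : unitInterval, (s : ℝ) • z ∈ diskD := by
    intro s
    have h0 := s.2.1
    have h1 := s.2.2
    have hz' : z.1 ^ 2 + z.2 ^ 2 ≤ 1 := hz
    change ((s : ℝ) * z.1) ^ 2 + ((s : ℝ) * z.2) ^ 2 ≤ 1
    have : (s : ℝ) ^ 2 ≤ 1 := by nlinarith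
    nlinarith [sq_nonneg z.1, sq_nonneg z.2, sq_nonneg (s : ℝ)]
  have hsc : Continuous fun s : unitInterval => (s : ℝ) • z := by fun_prop
  have hclopen : IsClopen {s : unitInterval | δ ((s : ℝ) • z) = 0} := by
    constructor
    · exact isClosed_eq (hδc.comp_continuous hsc hseg) continuous_const
    · rw [isOpen_iff_mem_nhds]
      intro s hs
      have ht : Filter.Tendsto (fun s : unitInterval => (s : ℝ) • z) (nhds s)
          (nhdsWithin ((s : ℝ) • z) diskD) :=
        tendsto_nhdsWithin_iff.2 ⟨hsc.tendsto s, Filter.Eventually.of_forall hseg⟩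
      exact ht.eventually (hloc _ (hseg s) hs)
  have huniv := hclopen.eq_univ ⟨0, by
    have : ((0 : unitInterval) : ℝ) • z = ptO := by rw [Set.Icc.coe_zero, zero_smul]; rfl
    simp only [mem_ofPred_eq, this, hO0]⟩
  have h1 : (1 : unitInterval) ∈ {s : unitInterval | δ ((s : ℝ) • z) = 0} := by
    rw [huniv]; trivial
  have h2 : δ z = 0 := by simpa using h1
  exact sub_eq_zero.1 h2

end
end

section
/- Let (F, φ) be a TC flow on D² such that the derivative DF(O) of the vector field F at O is the zero matrix. Then every h ∈ Sh(F) satisfies Dh(O) = id, i.e. the Jacobian matrix of h at O is the identity matrix. In other words, Sh(F) ⊆ ker j, where j assigns to a map its Jacobian matrix at O. -/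
open Set

noncomputable section

theorem aux_disk_nhds : diskD ∈ nhds ptO := by
  have : Continuous (fun p : Pt => p.1 ^ 2 + p.2 ^ 2) := by fun_prop
  have h1 : {p : Pt | p.1 ^ 2 + p.2 ^ 2 < 1} ∈ nhds ptO :=
    (isOpen_lt this continuous_const).mem_nhds (by simp [ptO])
  exact Filter.mem_of_superset h1 (fun p hp => (show p.1 ^ 2 + p.2 ^ 2 ≤ 1 from le_of_lt hp))

theorem aux_prod_nhds (t : ℝ) : diskD ×ˢ (univ : Set ℝ) ∈ nhds (ptO, t) :=
  prod_mem_nhds aux_disk_nhds Filter.univ_mem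

theorem aux_F0 (Φ : TCFlow) : Φ.F ptO = 0 :=
  (Φ.F_zero_iff ptO (mem_of_mem_nhds aux_disk_nhds)).2 rfl

theorem aux_fix (Φ : TCFlow) (t : ℝ) : Φ.φ ptO t = ptO := by
  have hO : ptO ∈ diskD := mem_of_mem_nhds aux_disk_nhds
  have hd : DifferentiableAt ℝ (fun p : Pt × ℝ => Φ.φ p.1 p.2) (Φ.φ ptO 0, t) := by
    rw [Φ.φ_zero ptO hO]
    exact (Φ.φ_smooth.contDiffAt (aux_prod_nhds t)).differentiableAt (by simp)
  have h1 := Φ.φ_deriv ptO hO 0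
  rw [Φ.φ_zero ptO hO, aux_F0] at h1
  have h2 : HasDerivAt (fun s : ℝ => (Φ.φ ptO s, t)) ((0 : Pt), (0 : ℝ)) 0 :=
    h1.prodMk (hasDerivAt_const _ _)
  have h3 := hd.hasFDerivAt.comp_hasDerivAt (0 : ℝ) h2
  have h4 : HasDerivAt (fun s : ℝ => Φ.φ ptO (s + t)) (Φ.F (Φ.φ ptO (0 + t))) 0 :=
    (Φ.φ_deriv ptO hO (0 + t)).comp_add_const 0 t
  have h5 : (fun s : ℝ => Φ.φ ptO (s + t)) =
      (fun p : Pt × ℝ => Φ.φ p.1 p.2) ∘ (fun s : ℝ => (Φ.φ ptO s, t)) := by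
    funext s
    simp [Φ.φ_add ptO hO]
  rw [h5] at h4
  have h6 := h4.unique h3
  have h7 : ((0 : Pt), (0 : ℝ)) = 0 := rfl
  rw [h7, map_zero, zero_add] at h6
  exact (Φ.F_zero_iff _ (Φ.φ_mapsTo ptO hO t)).1 h6

theorem aux_bound (Φ : TCFlow) (hF : fderiv ℝ Φ.F ptO = 0) (M ε : ℝ) (hM : 0 < M) (hε : 0 < ε) :
    ∀ᶠ z in nhds ptO, ∀ s ∈ Icc (-M) M, ‖Φ.φ z s - z‖ ≤ ‖z‖ * (Real.exp (M * ε) - 1) := by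
  have hFd : HasFDerivAt Φ.F (0 : Pt →L[ℝ] Pt) ptO := by
    rw [← hF]
    exact ((Φ.F_smooth.contDiffAt aux_disk_nhds).differentiableAt (by simp)).hasFDerivAt
  have h1 : ∀ᶠ w in nhds ptO, ‖Φ.F w‖ ≤ ε * ‖w‖ := by
    have := hFd.isLittleO.bound hε
    filter_upwards [this] with w hw
    have e : ptO = 0 := rfl
    rw [aux_F0, e] at hw
    simpa using hw
  have h2 : ∀ᶠ z in nhds ptO, ∀ s ∈ Icc (-M) M, ‖Φ.F (Φ.φ z s)‖ ≤ ε * ‖Φ.φ z s‖ := by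
    apply isCompact_Icc.eventually_forall_of_forall_eventually
    intro s _
    have hc : ContinuousAt (fun p : Pt × ℝ => Φ.φ p.1 p.2) (ptO, s) :=
      (Φ.φ_smooth.contDiffAt (aux_prod_nhds s)).continuousAt
    have : Filter.Tendsto (fun p : Pt × ℝ => Φ.φ p.1 p.2) (nhds (ptO, s)) (nhds ptO) := by
      have := hc.tendsto
      simpa only [aux_fix] using this
    exact this.eventually h1
  filter_upwards [h2, aux_disk_nhds] with z hz hzD s hs
  have hsM : |s| ≤ M := abs_le.2 hs
  have hder : ∀ t : ℝ, HasDerivAt (fun t => Φ.φ z (t * s) - z) (s • Φ.F (Φ.φ z (t * s))) t := by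
    intro t
    have := (Φ.φ_deriv z hzD (t * s)).scomp t (hasDerivAt_mul_const s)
    exact this.sub_const z
  have hme : 0 < M * ε := mul_pos hM hε
  have := norm_le_gronwallBound_of_norm_deriv_right_le (f := fun t => Φ.φ z (t * s) - z)
    (f' := fun t => s • Φ.F (Φ.φ z (t * s))) (δ := 0) (K := M * ε) (ε := M * ε * ‖z‖)
    (a := 0) (b := 1)
    (fun t _ => (hder t).continuousAt.continuousWithinAt)
    (fun t _ => (hder t).hasDerivWithinAt)
    (by simp [Φ.φ_zero z hzD])
    (by
      intro t ht
      have hts : t * s ∈ Icc (-M) M := by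
        rw [mem_Icc, ← abs_le, abs_mul, abs_of_nonneg ht.1]
        have := ht.2
        nlinarith [abs_nonneg s, ht.1]
      have hb := hz _ hts
      have htri : ‖Φ.φ z (t * s)‖ ≤ ‖Φ.φ z (t * s) - z‖ + ‖z‖ := by
        simpa using norm_add_le (Φ.φ z (t * s) - z) z
      rw [norm_smul, Real.norm_eq_abs]
      calc |s| * ‖Φ.F (Φ.φ z (t * s))‖ ≤ M * (ε * (‖Φ.φ z (t * s) - z‖ + ‖z‖)) := by
            gcongr
            exact hb.trans (by gcongr)
        _ = _ := by ring)
    1 (by simp)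
  rw [gronwallBound_of_K_ne_0 hme.ne'] at this
  simp only [one_mul, sub_zero, mul_one, zero_mul, zero_add] at this
  refine this.trans (le_of_eq ?_)
  field_simp

/-- if the linearization of `F` at `O` vanishes, then every `h ∈ Sh(F)` has
the identity as Jacobi matrix at `O`; that is, `Sh(F) ⊆ ker j`. -/
theorem ShMem_subset_ker_jet
    (Φ : TCFlow) (hF : fderiv ℝ Φ.F ptO = 0)
    (h : Pt → Pt) (hh : ShMem Φ h) :
    fderiv ℝ h ptO = ContinuousLinearMap.id ℝ Pt := by
  obtain ⟨α, hα, hhα⟩ := hh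
  have hO : ptO ∈ diskD := mem_of_mem_nhds aux_disk_nhds
  apply HasFDerivAt.fderiv
  rw [hasFDerivAt_iff_isLittleO, Asymptotics.isLittleO_iff]
  intro c hc
  have hac : ContinuousAt α ptO := (hα.contDiffAt aux_disk_nhds).continuousAt
  set M := |α ptO| + 1 with hMdef
  have hM : 0 < M := by positivity
  have hαM : ∀ᶠ z in nhds ptO, |α z| < M :=
    hac.abs.eventually (gt_mem_nhds (by simp [hMdef]))
  have hlog : 0 < Real.log (1 + c) := Real.log_pos (by linarith)
  have hb := aux_bound Φ hF M (Real.log (1 + c) / M) hM (by positivity)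
  filter_upwards [hαM, hb, aux_disk_nhds] with z h1 h2 hz
  have h3 := h2 (α z) (abs_le.1 h1.le)
  rw [mul_div_cancel₀ _ hM.ne', Real.exp_log (by linarith), ← hhα z hz] at h3
  have h4 : h ptO = 0 := by rw [hhα _ hO, aux_fix]; rfl
  have e : ptO = 0 := rfl
  rw [h4, e]
  simp only [sub_zero, ContinuousLinearMap.id_apply]
  linarith

end
end
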